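/- arXiv:0811.3256 — 7 statements merged into one kernel-verified Lean document; each statement's English description precedes it below -/
import Mathlib

section
/- Let l ≥ 1 be an integer, let k₁,…,k_l be positive integers with r = Σᵢ kᵢ, and let δ ∈ (0,1). Then there exist constants C = C(r,δ) > 0 and h₀ = h₀(r,δ) ≥ 3 such that for every real h ≥ h₀ and every choice of subintervals [Bᵢ, Cᵢ] ⊆ [0,h] (1 ≤ i ≤ l) with lengths dᵢ = Cᵢ − Bᵢ satisfying dᵢ ≥ h^δ for all i, one has |Σ 𝔖(A₁ ∪ ⋯ ∪ A_l) − ∏ᵢ₌₁^l dᵢ^{kᵢ}/kᵢ!| ≤ C·(∏ᵢ₌₁^l dᵢ^{kᵢ}/kᵢ!)·(1/log log h), where the sum runs over all l-tuples (A₁,…,A_l) of sets of integers such that Aᵢ ⊆ [Bᵢ, Cᵢ] and |Aᵢ| = kᵢ for each i. -/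
open Finset

/-- The sieve weight Λ_R(n; H, a) = (1/a!) Σ_{d | P(n,H), d ≤ R} μ(d) (log (R/d))^a,
where P(n,H) = ∏_{h ∈ H} (n+h). -/
noncomputable def lamR (R : ℝ) (n : ℕ) (H : Finset ℕ) (a : ℕ) : ℝ :=
  (1 / (Nat.factorial a : ℝ)) *
    ∑ d ∈ (∏ h ∈ H, (n + h)).divisors.filter (fun d : ℕ => (d : ℝ) ≤ R),
      (ArithmeticFunction.moebius d : ℝ) * (Real.log (R / d)) ^ a

/-- |Ω_H(p)|: the number of residue classes mod p occupied by the elements of H. -/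
def residCard (H : Finset ℕ) (p : ℕ) : ℕ := (H.image (fun h => h % p)).card

/-- The singular series 𝔖(H) = ∏_p (1 - |Ω_H(p)|/p) (1 - 1/p)^{-|H|}. -/
noncomputable def singSeries (H : Finset ℕ) : ℝ :=
  ∏' p : Nat.Primes,
    ((1 - (residCard H (p : ℕ) : ℝ) / (p : ℕ)) * ((1 - 1 / ((p : ℕ) : ℝ)) ^ H.card)⁻¹)

/-- The Euler factor at `p` of the singular series of `H`, normalised for sets of size `K`. -/
noncomputable def eulerFactor (H : Finset ℕ) (K p : ℕ) : ℝ :=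
  (1 - (residCard H p : ℝ) / p) * ((1 - 1 / (p : ℝ)) ^ K)⁻¹

lemma one_sub_pow_le (u : ℝ) (hu0 : 0 ≤ u) (hu1 : u ≤ 1) (K : ℕ) :
    (1 - u) ^ K ≤ 1 - K * u + K ^ 2 * u ^ 2 := by
  induction K with
  | zero => simp
  | succ K ih =>
    rw [pow_succ]
    push_cast
    have hK : (0 : ℝ) ≤ K := K.cast_nonneg
    nlinarith [mul_le_mul_of_nonneg_right ih (sub_nonneg.2 hu1), mul_nonneg hK (sq_nonneg u),
      mul_nonneg (sq_nonneg (K : ℝ)) (pow_nonneg hu0 3), sq_nonneg u]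

lemma residCard_le_card (H : Finset ℕ) (p : ℕ) : residCard H p ≤ H.card := card_image_le

lemma residCard_le (H : Finset ℕ) {p : ℕ} (hp : 0 < p) : residCard H p ≤ p := by
  have : H.image (fun h => h % p) ⊆ range p := by
    intro x hx
    obtain ⟨y, -, rfl⟩ := mem_image.1 hx
    exact mem_range.2 (Nat.mod_lt _ hp)
  exact (card_le_card this).trans_eq (card_range p)

lemma two_inv_pow_le {p : ℕ} (hp : 2 ≤ p) (K : ℕ) :
    ((1 - 1 / (p : ℝ)) ^ K)⁻¹ ≤ 2 ^ K := by
  have hp' : (2 : ℝ) ≤ p := by exact_mod_cast hp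
  have h1 : (1 / 2 : ℝ) ≤ 1 - 1 / p := by
    have : 1 / (p : ℝ) ≤ 1 / 2 := one_div_le_one_div_of_le (by norm_num) hp'
    linarith
  rw [← inv_pow]
  gcongr
  rw [inv_le_comm₀ (by linarith) (by norm_num)]
  linarith

lemma one_sub_inv_pos {p : ℕ} (hp : 2 ≤ p) : 0 < 1 - 1 / (p : ℝ) := by
  have hp' : (2 : ℝ) ≤ p := by exact_mod_cast hp
  rw [sub_pos, div_lt_one (by linarith)]
  linarith

lemma eulerFactor_nonneg (H : Finset ℕ) (K : ℕ) {p : ℕ} (hp : 2 ≤ p) :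
    0 ≤ eulerFactor H K p := by
  have h1 := one_sub_inv_pos hp
  have h2 : (residCard H p : ℝ) / p ≤ 1 := by
    rw [div_le_one (by positivity)]
    exact_mod_cast residCard_le H (by omega)
  exact mul_nonneg (by linarith) (by positivity)

lemma eulerFactor_le (H : Finset ℕ) (K : ℕ) {p : ℕ} (hp : 2 ≤ p) :
    eulerFactor H K p ≤ 2 ^ K := by
  have h1 := one_sub_inv_pos hp
  have h2 : (0 : ℝ) ≤ (residCard H p : ℝ) / p := by positivity
  calc eulerFactor H K p ≤ 1 * ((1 - 1 / (p : ℝ)) ^ K)⁻¹ := by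
        unfold eulerFactor
        gcongr
        linarith
    _ ≤ 2 ^ K := by rw [one_mul]; exact two_inv_pow_le hp K

lemma abs_eulerFactor_sub_one_le (H : Finset ℕ) {p : ℕ} (hp : 2 ≤ p) :
    |eulerFactor H H.card p - 1| ≤
      2 ^ H.card * ((H.card - residCard H p : ℝ) / p + H.card ^ 2 * ((p : ℝ) ^ 2)⁻¹) := by
  set K := H.card
  set w := residCard H p with hw
  have h1 := one_sub_inv_pos hp
  have hp0 : (0 : ℝ) < p := by positivity
  have hwK : (w : ℝ) ≤ K := by exact_mod_cast residCard_le_card H p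
  have e : eulerFactor H K p - 1 =
      ((1 - (w : ℝ) / p) - (1 - 1 / (p : ℝ)) ^ K) * ((1 - 1 / (p : ℝ)) ^ K)⁻¹ := by
    rw [sub_mul, mul_inv_cancel₀ (pow_pos h1 K).ne']
    rfl
  have hu0 : 0 ≤ 1 / (p : ℝ) := by positivity
  have hlow : 1 - K * (1 / (p : ℝ)) ≤ (1 - 1 / (p : ℝ)) ^ K := by
    have := one_add_mul_le_pow (a := -(1 / (p : ℝ))) (by linarith) K
    simpa [sub_eq_add_neg] using this
  have hup := one_sub_pow_le (1 / (p : ℝ)) hu0 (by linarith) K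
  have hdiff : ((K : ℝ) - w) / p = K * (1 / (p : ℝ)) - w / p := by ring
  have hsq : (1 / (p : ℝ)) ^ 2 = ((p : ℝ) ^ 2)⁻¹ := by rw [one_div, inv_pow]
  rw [hsq] at hup
  have hd0 : 0 ≤ ((K : ℝ) - w) / p := div_nonneg (by linarith) hp0.le
  have hq0 : 0 ≤ (K : ℝ) ^ 2 * ((p : ℝ) ^ 2)⁻¹ := by positivity
  have habs : |(1 - (w : ℝ) / p) - (1 - 1 / (p : ℝ)) ^ K| ≤
      ((K : ℝ) - w) / p + K ^ 2 * ((p : ℝ) ^ 2)⁻¹ := by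
    rw [abs_le]
    constructor <;> linarith
  rw [e, abs_mul, abs_of_nonneg (by positivity : 0 ≤ ((1 - 1 / (p : ℝ)) ^ K)⁻¹), mul_comm]
  exact mul_le_mul (two_inv_pow_le hp K) habs (abs_nonneg _) (by positivity)

/-- The product of all differences of two distinct elements of `H`. -/
def diffProd (H : Finset ℕ) : ℕ := ∏ x ∈ H.offDiag, ((x.1 : ℤ) - x.2).natAbs

lemma diffProd_ne_zero (H : Finset ℕ) : diffProd H ≠ 0 := by
  refine prod_ne_zero_iff.2 fun x hx => ?_
  have := (mem_offDiag.1 hx).2.2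
  omega

lemma diffProd_le (H : Finset ℕ) {h : ℝ} (h1 : 1 ≤ h) (hH : ∀ x ∈ H, (x : ℝ) ≤ h) :
    (diffProd H : ℝ) ≤ h ^ (H.card ^ 2) := by
  unfold diffProd
  push_cast
  calc _ ≤ ∏ _x ∈ H.offDiag, h := by
        refine prod_le_prod (fun _ _ => by positivity) fun x hx => ?_
        obtain ⟨ha, hb, -⟩ := mem_offDiag.1 hx
        have ha' := hH _ ha
        have hb' := hH _ hb
        rw [Nat.cast_natAbs]
        push_cast
        rw [abs_le]
        constructor <;> linarith [(x.1 : ℕ).cast_nonneg (α := ℝ), (x.2 : ℕ).cast_nonneg (α := ℝ)]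
    _ = h ^ H.offDiag.card := by rw [prod_const]
    _ ≤ _ := by
        refine pow_le_pow_right₀ h1 ?_
        rw [offDiag_card, sq]
        omega

lemma residCard_eq_card (H : Finset ℕ) {p : ℕ} (hp : ¬ p ∣ diffProd H) :
    residCard H p = H.card := by
  refine card_image_of_injOn fun a ha b hb hab => ?_
  by_contra hne
  refine hp (dvd_trans ?_ (dvd_prod_of_mem _ (mem_offDiag.2 ⟨ha, hb, hne⟩ : (a, b) ∈ H.offDiag)))
  have : a ≡ b [MOD p] := hab
  exact Int.natCast_dvd.1 this.symm.dvd

lemma card_prime_divisors_mul_log_le (s : Finset Nat.Primes) {Y D : ℕ} (hY : 0 < Y) (hD : D ≠ 0)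
    (hs : ∀ p ∈ s, Y < (p : ℕ)) (hd : ∀ p ∈ s, (p : ℕ) ∣ D) :
    s.card * Real.log Y ≤ Real.log D := by
  have h1 : ∏ p ∈ s, (p : ℕ) ∣ D := by
    have := Finset.prod_primes_dvd (s := s.map ⟨fun p : Nat.Primes => (p : ℕ), Subtype.val_injective⟩) D
      (fun a ha => by
        obtain ⟨p, -, rfl⟩ := mem_map.1 ha
        exact p.2.prime)
      (fun a ha => by
        obtain ⟨p, hp, rfl⟩ := mem_map.1 ha
        exact hd p hp)
    rwa [prod_map] at this
  have h2 : Y ^ s.card ≤ ∏ p ∈ s, (p : ℕ) := by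
    rw [← prod_const]
    exact prod_le_prod' fun p hp => (hs p hp).le
  have h3 : Y ^ s.card ≤ D := h2.trans (Nat.le_of_dvd (Nat.pos_of_ne_zero hD) h1)
  rw [← Real.log_pow]
  exact Real.log_le_log (by positivity) (by exact_mod_cast h3)

lemma sum_inv_sq_primes_le (s : Finset Nat.Primes) {Y : ℕ} (hY : 0 < Y)
    (hs : ∀ p ∈ s, Y < (p : ℕ)) :
    ∑ p ∈ s, (((p : ℕ) : ℝ) ^ 2)⁻¹ ≤ 1 / Y := by
  set t := s.map ⟨fun p : Nat.Primes => (p : ℕ), Subtype.val_injective⟩ with ht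
  have h0 : ∑ p ∈ s, (((p : ℕ) : ℝ) ^ 2)⁻¹ = ∑ n ∈ t, ((n : ℝ) ^ 2)⁻¹ := by rw [ht, sum_map]; rfl
  have h1 : t ⊆ Ioc Y (max Y (t.sup id)) := by
    intro n hn
    obtain ⟨p, hp, rfl⟩ := mem_map.1 hn
    exact mem_Ioc.2 ⟨hs p hp, le_max_of_le_right (le_sup (f := id) hn)⟩
  rw [h0]
  calc _ ≤ ∑ n ∈ Ioc Y (max Y (t.sup id)), ((n : ℝ) ^ 2)⁻¹ :=
        sum_le_sum_of_subset_of_nonneg h1 fun _ _ _ => by positivity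
    _ ≤ (Y : ℝ)⁻¹ - ((max Y (t.sup id) : ℕ) : ℝ)⁻¹ :=
        sum_Ioc_inv_sq_le_sub hY.ne' (le_max_left _ _)
    _ ≤ 1 / Y := by
        rw [one_div]
        have : (0 : ℝ) ≤ ((max Y (t.sup id) : ℕ) : ℝ)⁻¹ := by positivity
        linarith

/-- A bound for the sum of `|f_p - 1|` over the Euler factors `f_p` at primes exceeding `Y`. -/
lemma sum_abs_eulerFactor_sub_one_le (H : Finset ℕ) {r Y : ℕ} {h : ℝ} (hr : H.card ≤ r)
    (h1 : 1 ≤ h) (hH : ∀ x ∈ H, (x : ℝ) ≤ h) (hY : 2 ≤ Y) (s : Finset Nat.Primes)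
    (hs : ∀ p ∈ s, Y < (p : ℕ)) :
    ∑ p ∈ s, |eulerFactor H H.card p - 1| ≤
      2 ^ r * (r * (r ^ 2 * Real.log h / Real.log Y / Y) + r ^ 2 * (1 / Y)) := by
  classical
  have hY0 : (0 : ℝ) < Y := by positivity
  have hlogY : 0 < Real.log Y := Real.log_pos (by exact_mod_cast hY)
  have hlogh : 0 ≤ Real.log h := Real.log_nonneg h1
  have hrr : (H.card : ℝ) ≤ r := by exact_mod_cast hr
  set t : Finset Nat.Primes := s.filter (fun p : Nat.Primes => (p : ℕ) ∣ diffProd H) with ht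
  have hcard : (t.card : ℝ) ≤ r ^ 2 * Real.log h / Real.log Y := by
    rw [le_div_iff₀ hlogY]
    calc (t.card : ℝ) * Real.log Y ≤ Real.log (diffProd H) :=
          card_prime_divisors_mul_log_le t (by omega) (diffProd_ne_zero H)
            (fun p hp => hs p (mem_filter.1 hp).1) (fun p hp => (mem_filter.1 hp).2)
      _ ≤ Real.log (h ^ (H.card ^ 2)) :=
          Real.log_le_log (by exact_mod_cast Nat.pos_of_ne_zero (diffProd_ne_zero H))
            (diffProd_le H h1 hH)
      _ = (H.card : ℝ) ^ 2 * Real.log h := by rw [Real.log_pow]; push_cast; ring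
      _ ≤ r ^ 2 * Real.log h := by gcongr
  have hterm : ∀ p ∈ s, |eulerFactor H H.card p - 1| ≤
      2 ^ r * (r * (if (p : ℕ) ∣ diffProd H then 1 / (Y : ℝ) else 0)
        + r ^ 2 * (((p : ℕ) : ℝ) ^ 2)⁻¹) := by
    intro p hp
    have hYp : (Y : ℝ) ≤ (p : ℕ) := by exact_mod_cast (hs p hp).le
    have hres : (residCard H p : ℝ) ≤ H.card := by exact_mod_cast residCard_le_card H p
    have key : (H.card - residCard H p : ℝ) / (p : ℕ) ≤
        r * (if (p : ℕ) ∣ diffProd H then 1 / (Y : ℝ) else 0) := by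
      split_ifs with hd
      · rw [mul_one_div]
        have : (0 : ℝ) ≤ residCard H p := by positivity
        gcongr
        linarith
      · rw [residCard_eq_card H hd]
        simp
    refine (abs_eulerFactor_sub_one_le H p.2.two_le).trans ?_
    have : (0 : ℝ) ≤ (H.card - residCard H p : ℝ) / (p : ℕ) :=
      div_nonneg (by linarith) (by positivity)
    gcongr
    norm_num
  calc _ ≤ _ := sum_le_sum hterm
    _ = 2 ^ r * (r * (t.card * (1 / Y)) + r ^ 2 * ∑ p ∈ s, (((p : ℕ) : ℝ) ^ 2)⁻¹) := by
        rw [← mul_sum, sum_add_distrib, ← mul_sum, ← mul_sum, ← sum_filter, sum_const,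
          nsmul_eq_mul]
    _ ≤ _ := by
        have := sum_inv_sq_primes_le s (by omega : 0 < Y) hs
        rw [mul_one_div]
        gcongr

/-- The primes up to `Y`, as a finset of `Nat.Primes`. -/
def smallPrimes (Y : ℕ) : Finset Nat.Primes := Finset.subtype Nat.Prime (range (Y + 1))

lemma mem_smallPrimes {Y : ℕ} {p : Nat.Primes} : p ∈ smallPrimes Y ↔ (p : ℕ) ≤ Y := by
  refine (Finset.mem_subtype (p := Nat.Prime)).trans ?_
  rw [mem_range, Nat.lt_succ_iff]

lemma abs_singSeries_sub_le (H : Finset ℕ) (Y : ℕ) (η : ℝ)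
    (hη : ∀ s : Finset Nat.Primes, (∀ p ∈ s, Y < (p : ℕ)) →
      ∑ p ∈ s, |eulerFactor H H.card p - 1| ≤ η) :
    |singSeries H - ∏ p ∈ smallPrimes Y, eulerFactor H H.card p| ≤
      (Real.exp η - 1) * ∏ p ∈ smallPrimes Y, eulerFactor H H.card p := by
  classical
  set f : Nat.Primes → ℝ := fun p => eulerFactor H H.card p with hf
  set G := ∏ p ∈ smallPrimes Y, eulerFactor H H.card p with hG
  have hG0 : 0 ≤ G := prod_nonneg fun p _ => eulerFactor_nonneg H _ p.2.two_le
  have hsum : Summable fun p => |f p - 1| := by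
    refine summable_of_sum_le (c := ∑ p ∈ smallPrimes Y, |f p - 1| + η)
      (fun _ => abs_nonneg _) fun u => ?_
    rw [← sum_filter_add_sum_filter_not u (fun p : Nat.Primes => (p : ℕ) ≤ Y)]
    refine add_le_add ?_ (hη _ fun p hp => not_le.1 (mem_filter.1 hp).2)
    exact sum_le_sum_of_subset_of_nonneg
      (fun p hp => mem_smallPrimes.2 (mem_filter.1 hp).2) fun _ _ _ => abs_nonneg _
  have hmul : Multipliable f := by
    have := multipliable_one_add_of_summable (f := fun p => f p - 1)
      (by simpa [Real.norm_eq_abs] using hsum)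
    simpa using this
  have hlim : Filter.Tendsto (fun s : Finset Nat.Primes => |∏ p ∈ s, f p - G|) Filter.atTop
      (nhds |singSeries H - G|) := (hmul.hasProd.sub_const G).abs
  refine le_of_tendsto hlim ?_
  filter_upwards [Filter.eventually_ge_atTop (smallPrimes Y)] with s hs
  have hsplit : ∏ p ∈ s, f p = (∏ p ∈ s \ smallPrimes Y, f p) * G :=
    (prod_sdiff (f := f) hs).symm
  have htail : |∏ p ∈ s \ smallPrimes Y, f p - 1| ≤ Real.exp η - 1 := by
    have h1 := Finset.norm_prod_one_add_sub_one_le (s \ smallPrimes Y) (fun p => f p - 1)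
    simp only [add_sub_cancel, Real.norm_eq_abs] at h1
    refine h1.trans (sub_le_sub_right (Real.exp_le_exp.2 (hη _ fun p hp => ?_)) 1)
    have := (mem_sdiff.1 hp).2
    rw [mem_smallPrimes] at this
    omega
  rw [hsplit, show (∏ p ∈ s \ smallPrimes Y, f p) * G - G =
    (∏ p ∈ s \ smallPrimes Y, f p - 1) * G by ring, abs_mul, abs_of_nonneg hG0]
  exact mul_le_mul_of_nonneg_right htail hG0

/-- On average over all maps `u : α → ZMod q`, the proportion of classes missed by `u` is
`(1 - 1 / q) ^ |α|`. -/
lemma sum_one_sub_card_image_div {α : Type*} [Fintype α] [DecidableEq α] {q : ℕ} [NeZero q] :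
    ∑ u : α → ZMod q, (1 - ((univ.image u).card : ℝ) / q) =
      (q : ℝ) ^ Fintype.card α * (1 - 1 / (q : ℝ)) ^ Fintype.card α := by
  have hq : (q : ℝ) ≠ 0 := by exact_mod_cast NeZero.ne q
  have h1 : ∀ u : α → ZMod q, (1 - ((univ.image u).card : ℝ) / q) =
      (1 / q) * ∑ n : ZMod q, ∏ a, (if u a ≠ n then (1 : ℝ) else 0) := by
    intro u
    have h2 : ∀ n : ZMod q, ∏ a, (if u a ≠ n then (1 : ℝ) else 0) =
        if n ∈ (univ.image u)ᶜ then 1 else 0 := by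
      intro n
      rw [Finset.prod_ite_zero]
      simp
    have h3 : (univ.image u).card + (univ.image u)ᶜ.card = q := by
      rw [card_add_card_compl, ZMod.card]
    have h4 : ((univ.image u).card : ℝ) = q - (univ.image u)ᶜ.card := by
      rw [eq_sub_iff_add_eq]
      exact_mod_cast h3
    simp_rw [h2]
    rw [sum_boole, h4]
    simp only [filter_mem_eq_inter, univ_inter]
    field_simp
    ring
  have h5 : ∀ n : ZMod q, ∑ x : ZMod q, (if x ≠ n then (1 : ℝ) else 0) = q - 1 := by
    intro n
    rw [sum_boole, filter_ne', card_erase_of_mem (mem_univ _), card_univ, ZMod.card,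
      Nat.cast_sub (NeZero.one_le), Nat.cast_one]
  simp_rw [h1]
  rw [← mul_sum, sum_comm]
  have h6 : ∀ n : ZMod q, ∑ u : α → ZMod q, ∏ a, (if u a ≠ n then (1 : ℝ) else 0) =
      (q - 1) ^ Fintype.card α := by
    intro n
    have := prod_univ_sum (fun _ : α => (univ : Finset (ZMod q)))
      (fun _ x => if x ≠ n then (1 : ℝ) else 0)
    rw [Fintype.piFinset_univ] at this
    rw [← this]
    simp_rw [h5]
    rw [prod_const, card_univ]
  simp_rw [h6]
  rw [sum_const, card_univ, ZMod.card, nsmul_eq_mul, ← mul_assoc, one_div_mul_cancel hq, one_mul,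
    ← mul_pow, mul_sub, mul_one, mul_one_div_cancel hq]

lemma sum_prod_one_sub_card_image_div {ι α : Type*} [Fintype ι] [DecidableEq ι] [Fintype α]
    [DecidableEq α] (q : ι → ℕ) (hq : ∀ i, 2 ≤ q i) (hco : Pairwise (Function.onFun Nat.Coprime q))
    [NeZero (∏ i, q i)] :
    ∑ c : α → ZMod (∏ i, q i), ∏ i, ((1 - ((univ.image fun a =>
      ZMod.castHom (dvd_prod_of_mem q (mem_univ i)) (ZMod (q i)) (c a)).card : ℝ) / q i) *
        ((1 - 1 / (q i : ℝ)) ^ Fintype.card α)⁻¹) = ((∏ i, q i : ℕ) : ℝ) ^ Fintype.card α := by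
  have : ∀ i, NeZero (q i) := fun i => ⟨by have := hq i; omega⟩
  set φ : ∀ i, (α → ZMod (q i)) → ℝ := fun i u =>
    (1 - ((univ.image u).card : ℝ) / q i) * ((1 - 1 / (q i : ℝ)) ^ Fintype.card α)⁻¹ with hφ
  let e : (α → ZMod (∏ i, q i)) ≃ (∀ i, α → ZMod (q i)) :=
    (Equiv.arrowCongr (Equiv.refl α) (ZMod.prodEquivPi q hco).toEquiv).trans (Equiv.piComm _)
  have he : ∀ c i, e c i = fun a =>
      ZMod.castHom (dvd_prod_of_mem q (mem_univ i)) (ZMod (q i)) (c a) := by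
    intro c i
    funext a
    exact ZMod.prodEquivPi_apply q hco (c a) i
  calc _ = ∑ c : α → ZMod (∏ i, q i), ∏ i, φ i (e c i) := by
        refine sum_congr rfl fun c _ => prod_congr rfl fun i _ => ?_
        rw [he]
    _ = ∑ g : ∀ i, α → ZMod (q i), ∏ i, φ i (g i) :=
        e.sum_comp (fun g => ∏ i, φ i (g i))
    _ = ∏ i, ∑ u : α → ZMod (q i), φ i u := by
        rw [prod_univ_sum, Fintype.piFinset_univ]
    _ = ∏ i, (q i : ℝ) ^ Fintype.card α := by
        refine prod_congr rfl fun i _ => ?_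
        rw [hφ, ← sum_mul, sum_one_sub_card_image_div, mul_assoc,
          mul_inv_cancel₀ (pow_pos (one_sub_inv_pos (hq i)) _).ne', mul_one]
    _ = _ := by rw [prod_pow]; push_cast; rfl

lemma abs_card_Icc_filter_sub_le {P : ℕ} [NeZero P] (v : ZMod P) {B C : ℝ} (hB : 0 ≤ B)
    (hBC : B ≤ C) :
    |(((Icc ⌈B⌉₊ ⌊C⌋₊).filter (fun n : ℕ => (n : ZMod P) = v)).card : ℝ) - (C - B) / P| ≤ 2 := by
  have hP : 0 < P := NeZero.pos P
  have hP1 : (1 : ℝ) ≤ P := by exact_mod_cast hP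
  have h1 : (Icc ⌈B⌉₊ ⌊C⌋₊).filter (fun n : ℕ => (n : ZMod P) = v) =
      (Ico ⌈B⌉₊ (⌊C⌋₊ + 1)).filter (fun n : ℕ => n ≡ v.val [MOD P]) := by
    rw [show Icc ⌈B⌉₊ ⌊C⌋₊ = Ico ⌈B⌉₊ (⌊C⌋₊ + 1) by ext; simp]
    refine filter_congr fun n _ => ?_
    rw [← ZMod.natCast_eq_natCast_iff, ZMod.natCast_zmod_val]
  have h2 := Nat.Ico_filter_modEq_card ⌈B⌉₊ (⌊C⌋₊ + 1) hP v.val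
  rw [h1]
  set N := ((Ico ⌈B⌉₊ (⌊C⌋₊ + 1)).filter (fun n : ℕ => n ≡ v.val [MOD P])).card
  have ha1 := Nat.le_ceil B
  have ha2 := Nat.ceil_lt_add_one hB
  have hb1 := Nat.floor_le (hB.trans hBC)
  have hb2 := Nat.lt_floor_add_one C
  have hab : ⌈B⌉₊ ≤ ⌊C⌋₊ + 1 := by
    have : (⌈B⌉₊ : ℝ) < (⌊C⌋₊ + 1 + 1 : ℕ) := by push_cast; linarith
    exact Nat.lt_succ_iff.1 (by exact_mod_cast this)
  have hQ : (0 : ℚ) < P := by exact_mod_cast hP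
  have hmono : ⌈((⌈B⌉₊ : ℚ) - v.val) / P⌉ ≤ ⌈(((⌊C⌋₊ + 1 : ℕ) : ℚ) - v.val) / P⌉ := by
    gcongr
  rw [max_eq_left (by linarith)] at h2
  have hN : (N : ℚ) = ⌈(((⌊C⌋₊ + 1 : ℕ) : ℚ) - v.val) / P⌉ - ⌈((⌈B⌉₊ : ℚ) - v.val) / P⌉ := by
    exact_mod_cast h2
  have hN' : |(N : ℚ) - (((⌊C⌋₊ + 1 : ℕ) : ℚ) - ⌈B⌉₊) / P| ≤ 1 := by
    have e1 := Int.le_ceil ((((⌊C⌋₊ + 1 : ℕ) : ℚ) - v.val) / P)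
    have e2 := Int.ceil_lt_add_one ((((⌊C⌋₊ + 1 : ℕ) : ℚ) - v.val) / P)
    have e3 := Int.le_ceil (((⌈B⌉₊ : ℚ) - v.val) / P)
    have e4 := Int.ceil_lt_add_one (((⌈B⌉₊ : ℚ) - v.val) / P)
    have e5 : (((⌊C⌋₊ + 1 : ℕ) : ℚ) - ⌈B⌉₊) / P =
      (((⌊C⌋₊ + 1 : ℕ) : ℚ) - v.val) / P - ((⌈B⌉₊ : ℚ) - v.val) / P := by ring
    rw [hN, e5, abs_le]
    constructor <;> linarith
  have hN'' : |(N : ℝ) - (((⌊C⌋₊ + 1 : ℕ) : ℝ) - ⌈B⌉₊) / P| ≤ 1 := by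
    have := (Rat.cast_le (K := ℝ)).2 hN'
    push_cast at this ⊢
    exact this
  have hd : |(((⌊C⌋₊ + 1 : ℕ) : ℝ) - ⌈B⌉₊) / P - (C - B) / P| ≤ 1 := by
    rw [← sub_div, abs_div, abs_of_pos (by linarith : (0 : ℝ) < P), div_le_one (by linarith)]
    refine le_trans ?_ hP1
    push_cast
    rw [abs_le]
    constructor <;> linarith
  calc _ ≤ _ := abs_sub_le _ ((((⌊C⌋₊ + 1 : ℕ) : ℝ) - ⌈B⌉₊) / P) _
    _ ≤ 2 := by linarith

/-- If each `x a` is within a relative error `ε` of `y a`, the products are close. -/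
lemma abs_prod_sub_prod_le {α : Type*} [Fintype α] (x y : α → ℝ) (hy : ∀ a, 0 < y a) {ε : ℝ}
    (hxy : ∀ a, |x a - y a| ≤ ε * y a) :
    |∏ a, x a - ∏ a, y a| ≤ (∏ a, y a) * (Real.exp (Fintype.card α * ε) - 1) := by
  have h1 : ∏ a, x a = (∏ a, y a) * ∏ a, (1 + (x a - y a) / y a) := by
    rw [← prod_mul_distrib]
    refine prod_congr rfl fun a _ => ?_
    have := (hy a).ne'
    field_simp
    ring
  have hY : 0 < ∏ a, y a := prod_pos fun a _ => hy a
  rw [h1, show (∏ a, y a) * ∏ a, (1 + (x a - y a) / y a) - ∏ a, y a =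
    (∏ a, y a) * (∏ a, (1 + (x a - y a) / y a) - 1) by ring, abs_mul, abs_of_pos hY]
  refine mul_le_mul_of_nonneg_left ?_ hY.le
  have h2 := Finset.norm_prod_one_add_sub_one_le univ (fun a => (x a - y a) / y a)
  simp only [Real.norm_eq_abs] at h2
  refine h2.trans (sub_le_sub_right (Real.exp_le_exp.2 ?_) 1)
  rw [← card_univ, ← nsmul_eq_mul, ← sum_const]
  refine sum_le_sum fun a _ => ?_
  rw [abs_div, abs_of_pos (hy a), div_le_iff₀ (hy a)]
  exact hxy a

/-- The truncation at `Y` of the singular series of the image of `f`, normalised as if `f` were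
injective. -/
noncomputable def truncSeries {α : Type*} [Fintype α] (Y : ℕ) (f : α → ℕ) : ℝ :=
  ∏ p ∈ smallPrimes Y, eulerFactor (univ.image f) (Fintype.card α) p

lemma truncSeries_nonneg {α : Type*} [Fintype α] (Y : ℕ) (f : α → ℕ) : 0 ≤ truncSeries Y f :=
  prod_nonneg fun p _ => eulerFactor_nonneg _ _ p.2.two_le

lemma prod_smallPrimes (Y : ℕ) : ∏ p ∈ smallPrimes Y, (p : ℕ) = primorial Y := by
  unfold smallPrimes primorial
  exact Finset.prod_subtype_eq_prod_filter (p := Nat.Prime) (fun p => p)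

/-- The sum of `truncSeries` over a box of tuples: the main term and its error. -/
lemma abs_sum_truncSeries_sub_le {α : Type*} [Fintype α] [DecidableEq α] (Y : ℕ) (B C : α → ℝ)
    (hB : ∀ a, 0 ≤ B a) {X : ℝ} (hX : 0 < X) (hP : (primorial Y : ℝ) ≤ X)
    (hd : ∀ a, X ^ 2 ≤ C a - B a) :
    |∑ f ∈ Fintype.piFinset (fun a => Icc ⌈B a⌉₊ ⌊C a⌋₊), truncSeries Y f - ∏ a, (C a - B a)| ≤
      (∏ a, (C a - B a)) * (Real.exp (Fintype.card α * (2 / X)) - 1) := by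
  classical
  set q : smallPrimes Y → ℕ := fun i => (i.1 : ℕ) with hq
  have hPq : ∏ i, q i = primorial Y := by
    rw [← prod_smallPrimes, ← prod_coe_sort (smallPrimes Y) fun p => (p : ℕ)]
  have hprime : ∀ i, (q i).Prime := fun i => i.1.2
  have hco : Pairwise (Function.onFun Nat.Coprime q) := fun i j hij =>
    (Nat.coprime_primes (hprime i) (hprime j)).2 fun h => hij (Subtype.ext (Subtype.ext h))
  rw [← hPq] at hP
  set P := ∏ i, q i with hPdef
  have : NeZero P := ⟨prod_ne_zero_iff.2 fun i _ => (hprime i).ne_zero⟩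
  have hP0 : (0 : ℝ) < P := by exact_mod_cast NeZero.pos P
  set g : (α → ZMod P) → ℝ := fun c => ∏ i, ((1 - ((univ.image fun a =>
      ZMod.castHom (dvd_prod_of_mem q (mem_univ i)) (ZMod (q i)) (c a)).card : ℝ) / q i) *
        ((1 - 1 / (q i : ℝ)) ^ Fintype.card α)⁻¹) with hg
  have hgsum : ∑ c, g c = (P : ℝ) ^ Fintype.card α :=
    sum_prod_one_sub_card_image_div q (fun i => (hprime i).two_le) hco
  have hfg : ∀ f : α → ℕ, truncSeries Y f = g (fun a => (f a : ZMod P)) := by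
    intro f
    rw [truncSeries, ← prod_coe_sort]
    refine prod_congr rfl fun i _ => ?_
    have hc : (univ.image fun a => ZMod.castHom (dvd_prod_of_mem q (mem_univ i)) (ZMod (q i))
        (f a : ZMod P)).card = residCard (univ.image f) (q i) := by
      have himg : (univ.image fun a => ((f a : ℕ) : ZMod (q i))) =
          ((univ.image f).image (fun h => h % q i)).image (fun n : ℕ => (n : ZMod (q i))) := by
        rw [image_image, image_image]
        refine image_congr fun a _ => ?_
        simp
      simp only [map_natCast]
      rw [himg, card_image_of_injOn, residCard]
      intro x hx y hy hxy
      obtain ⟨a, -, rfl⟩ := mem_image.1 (mem_coe.1 hx)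
      obtain ⟨b, -, rfl⟩ := mem_image.1 (mem_coe.1 hy)
      have := (ZMod.natCast_eq_natCast_iff _ _ _).1 hxy
      simpa [Nat.ModEq] using this
    exact congrArg (fun t : ℕ => (1 - (t : ℝ) / q i) *
      ((1 - 1 / (q i : ℝ)) ^ Fintype.card α)⁻¹) hc.symm
  have hg0 : ∀ c, 0 ≤ g c := by
    intro c
    have := hfg (fun a => (c a).val)
    simp only [ZMod.natCast_zmod_val] at this
    rw [← this]
    exact truncSeries_nonneg _ _
  set N : α → ZMod P → ℝ := fun a v =>
    (((Icc ⌈B a⌉₊ ⌊C a⌋₊).filter (fun n : ℕ => (n : ZMod P) = v)).card : ℝ) with hN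
  have hsum : ∑ f ∈ Fintype.piFinset (fun a => Icc ⌈B a⌉₊ ⌊C a⌋₊), truncSeries Y f =
      ∑ c, g c * ∏ a, N a (c a) := by
    rw [← sum_fiberwise (Fintype.piFinset fun a => Icc ⌈B a⌉₊ ⌊C a⌋₊)
      (fun f a => (f a : ZMod P))]
    refine sum_congr rfl fun c _ => ?_
    have h1 : (Fintype.piFinset fun a => Icc ⌈B a⌉₊ ⌊C a⌋₊).filter
        (fun f => (fun a => (f a : ZMod P)) = c) = Fintype.piFinset fun a =>
          (Icc ⌈B a⌉₊ ⌊C a⌋₊).filter (fun n : ℕ => (n : ZMod P) = c a) := by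
      ext f
      simp only [mem_filter, Fintype.mem_piFinset, funext_iff, forall_and]
    rw [sum_congr rfl (g := fun _ => g c) (fun f hf => by
      rw [hfg, (mem_filter.1 hf).2]), sum_const, h1, Fintype.card_piFinset, nsmul_eq_mul, mul_comm]
    push_cast
    rfl
  have hdpos : ∀ a, 0 < C a - B a := fun a => (pow_pos hX 2).trans_le (hd a)
  have hmain : ∏ a, (C a - B a) = ∑ c, g c * ∏ a, ((C a - B a) / P) := by
    rw [← sum_mul, hgsum, prod_div_distrib, prod_const, card_univ]
    field_simp
  have hN' : ∀ c : α → ZMod P, |∏ a, N a (c a) - ∏ a, ((C a - B a) / P)| ≤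
      (∏ a, ((C a - B a) / P)) * (Real.exp (Fintype.card α * (2 / X)) - 1) := by
    intro c
    refine abs_prod_sub_prod_le _ _ (fun a => div_pos (hdpos a) hP0) fun a => ?_
    refine (abs_card_Icc_filter_sub_le (c a) (hB a) (by linarith [hdpos a])).trans ?_
    rw [div_mul_div_comm, le_div_iff₀ (by positivity)]
    nlinarith [hd a, mul_le_mul_of_nonneg_left hP hX.le]
  rw [hsum]
  nth_rw 1 [hmain]
  rw [← sum_sub_distrib]
  refine (abs_sum_le_sum_abs _ _).trans ?_
  rw [hmain, sum_mul]
  refine sum_le_sum fun c _ => ?_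
  rw [← mul_sub, abs_mul, abs_of_nonneg (hg0 c), mul_assoc]
  exact mul_le_mul_of_nonneg_left (hN' c) (hg0 c)

lemma card_piFinset_filter_injective {β : Type*} [Fintype β] [DecidableEq β] (A : Finset ℕ) :
    ((Fintype.piFinset fun _ : β => A).filter Function.Injective).card =
      A.card.descFactorial (Fintype.card β) := by
  rw [← Fintype.card_coe A, ← Fintype.card_embedding_eq, ← card_univ (α := β ↪ A)]
  refine card_bij' (fun f hf => ⟨fun b => ⟨f b, Fintype.mem_piFinset.1 (mem_filter.1 hf).1 b⟩,
    fun x y hxy => (mem_filter.1 hf).2 (congrArg Subtype.val hxy)⟩) (fun e _ b => (e b : ℕ))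
    (fun _ _ => mem_univ _) (fun e _ => ?_) (fun _ _ => rfl) (fun _ _ => rfl)
  exact mem_filter.2 ⟨Fintype.mem_piFinset.2 fun b => (e b).2,
    fun x y hxy => e.injective (Subtype.ext hxy)⟩

/-- Passing from tuples of sets to ordered tuples that are injective on each block. -/
lemma prod_factorial_mul_sum_biUnion {l : ℕ} (k : Fin l → ℕ) (I : Fin l → Finset ℕ)
    (Φ : Finset ℕ → ℝ) :
    ((∏ i, (k i).factorial : ℕ) : ℝ) *
      ∑ A ∈ Fintype.piFinset (fun i => (I i).powerset.filter (fun s => s.card = k i)),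
        Φ (univ.biUnion A) =
      ∑ f ∈ (Fintype.piFinset fun a : Σ i, Fin (k i) => I a.1).filter
        (fun f => ∀ i, Function.Injective fun j => f ⟨i, j⟩), Φ (univ.image f) := by
  classical
  set J := (Fintype.piFinset fun a : Σ i, Fin (k i) => I a.1).filter
    (fun f => ∀ i, Function.Injective fun j => f ⟨i, j⟩) with hJ
  let rows : ((Σ i, Fin (k i)) → ℕ) → Fin l → Finset ℕ := fun f i => univ.image fun j => f ⟨i, j⟩
  have hmaps : ∀ f ∈ J, rows f ∈
      Fintype.piFinset (fun i => (I i).powerset.filter (fun s => s.card = k i)) := by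
    intro f hf
    obtain ⟨hf1, hf2⟩ := mem_filter.1 hf
    refine Fintype.mem_piFinset.2 fun i => mem_filter.2 ⟨mem_powerset.2 fun x hx => ?_, ?_⟩
    · obtain ⟨j, -, rfl⟩ := mem_image.1 hx
      exact Fintype.mem_piFinset.1 hf1 ⟨i, j⟩
    · rw [card_image_of_injective _ (hf2 i), card_univ, Fintype.card_fin]
  have hrows : ∀ f, univ.image f = univ.biUnion (rows f) := by
    intro f
    ext x
    simp [rows, Sigma.exists]
  rw [← sum_fiberwise_of_maps_to hmaps, mul_sum]
  refine sum_congr rfl fun A hA => ?_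
  rw [sum_congr rfl (g := fun _ => Φ (univ.biUnion A)) (fun f hf => by
    rw [hrows, (mem_filter.1 hf).2]), sum_const, nsmul_eq_mul]
  congr 2
  have hA' : ∀ i, A i ⊆ I i ∧ (A i).card = k i := fun i => by
    simpa using Fintype.mem_piFinset.1 hA i
  have h1 : (Fintype.piFinset fun i => (Fintype.piFinset fun _ : Fin (k i) => A i).filter
      Function.Injective).card = ∏ i, (k i).factorial := by
    rw [Fintype.card_piFinset]
    refine prod_congr rfl fun i _ => ?_
    rw [card_piFinset_filter_injective, (hA' i).2, Fintype.card_fin, Nat.descFactorial_self]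
  rw [← h1]
  refine card_bij' (fun F _ a => F a.1 a.2) (fun f _ i j => f ⟨i, j⟩) (fun F hF => ?_)
    (fun f hf => ?_) (fun _ _ => rfl) (fun _ _ => rfl)
  · have hF' : ∀ i, (∀ j, F i j ∈ A i) ∧ Function.Injective (F i) := fun i => by
      simpa using Fintype.mem_piFinset.1 hF i
    refine mem_filter.2 ⟨mem_filter.2 ⟨Fintype.mem_piFinset.2 fun a =>
      (hA' a.1).1 ((hF' a.1).1 a.2), fun i => (hF' i).2⟩, funext fun i => ?_⟩
    refine eq_of_subset_of_card_le (fun x hx => ?_) ?_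
    · obtain ⟨j, -, rfl⟩ := mem_image.1 hx
      exact (hF' i).1 j
    · rw [card_image_of_injective _ (hF' i).2, card_univ, Fintype.card_fin, (hA' i).2]
  · obtain ⟨hf1, hf2⟩ := mem_filter.1 hf
    refine Fintype.mem_piFinset.2 fun i => mem_filter.2
      ⟨Fintype.mem_piFinset.2 fun j => ?_, (mem_filter.1 hf1).2 i⟩
    rw [← hf2]
    exact mem_image_of_mem _ (mem_univ j)

lemma card_piFinset_filter_apply_eq_le {α : Type*} [Fintype α] [DecidableEq α]
    (I : α → Finset ℕ) {a b : α} (hab : a ≠ b) :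
    ((Fintype.piFinset I).filter fun f => f a = f b).card ≤ ∏ c ∈ univ.erase b, (I c).card := by
  have h1 : (Fintype.piFinset (Function.update I b {0})).card =
      ∏ c ∈ univ.erase b, (I c).card := by
    rw [Fintype.card_piFinset, ← mul_prod_erase univ _ (mem_univ b), Function.update_self,
      card_singleton, one_mul]
    refine prod_congr rfl fun c hc => ?_
    rw [Function.update_of_ne (ne_of_mem_erase hc)]
  rw [← h1]
  refine card_le_card_of_injOn (fun f => Function.update f b 0) (fun f hf => ?_) ?_
  · have hf' := Fintype.mem_piFinset.1 (mem_filter.1 hf).1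
    refine mem_coe.2 (Fintype.mem_piFinset.2 fun c => ?_)
    rcases eq_or_ne c b with rfl | hc
    · simp
    · simpa [Function.update_of_ne hc] using hf' c
  · intro f hf g hg hfg
    have hne : ∀ c, c ≠ b → f c = g c := fun c hc => by
      simpa [Function.update_of_ne hc] using congrFun hfg c
    funext c
    rcases eq_or_ne c b with rfl | hc
    · rw [← (mem_filter.1 hf).2, ← (mem_filter.1 hg).2]
      exact hne a hab
    · exact hne c hc

/-- Few tuples in a box with long sides have a repeated entry. -/
lemma card_piFinset_filter_not_injective_le {α : Type*} [Fintype α] [DecidableEq α]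
    (I : α → Finset ℕ) (d : α → ℝ) {X : ℝ} (hX : 1 ≤ X) (hd : ∀ a, X ≤ d a)
    (hI : ∀ a, ((I a).card : ℝ) ≤ d a + 1) :
    (((Fintype.piFinset I).filter fun f => ¬ Function.Injective f).card : ℝ) * X ≤
      (Fintype.card α) ^ 2 * 2 ^ Fintype.card α * ∏ a, d a := by
  have hd0 : ∀ a, 0 < d a := fun a => by linarith [hd a]
  have hsub : ((Fintype.piFinset I).filter fun f => ¬ Function.Injective f) ⊆
      (univ : Finset α).offDiag.biUnion fun x =>
        (Fintype.piFinset I).filter fun f => f x.1 = f x.2 := by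
    intro f hf
    obtain ⟨hf1, hf2⟩ := mem_filter.1 hf
    obtain ⟨a, b, hab, hne⟩ := Function.not_injective_iff.1 hf2
    exact mem_biUnion.2 ⟨(a, b), by simpa using hne, mem_filter.2 ⟨hf1, hab⟩⟩
  have hone : ∀ x ∈ (univ : Finset α).offDiag,
      (((Fintype.piFinset I).filter fun f => f x.1 = f x.2).card : ℝ) * X ≤
        2 ^ Fintype.card α * ∏ a, d a := by
    intro x hx
    have hne := (mem_offDiag.1 hx).2.2
    calc (((Fintype.piFinset I).filter fun f => f x.1 = f x.2).card : ℝ) * X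
        ≤ (∏ c ∈ univ.erase x.2, ((I c).card : ℝ)) * X := by
          have := card_piFinset_filter_apply_eq_le I hne
          gcongr
          exact_mod_cast this
      _ ≤ (∏ c ∈ univ.erase x.2, 2 * d c) * (2 * d x.2) := by
          have h2 : ∏ c ∈ univ.erase x.2, ((I c).card : ℝ) ≤ ∏ c ∈ univ.erase x.2, 2 * d c :=
            prod_le_prod (fun _ _ => by positivity) fun c _ => by linarith [hI c, hd c]
          have h3 : 0 ≤ ∏ c ∈ univ.erase x.2, 2 * d c :=
            prod_nonneg fun c _ => by linarith [hd0 c]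
          exact mul_le_mul h2 (by linarith [hd x.2, hd0 x.2]) (by linarith) h3
      _ = ∏ c, 2 * d c := prod_erase_mul univ _ (mem_univ _)
      _ = 2 ^ Fintype.card α * ∏ a, d a := by rw [prod_mul_distrib, prod_const, card_univ]
  have hD : 0 ≤ ∏ a, d a := prod_nonneg fun a _ => (hd0 a).le
  calc _ ≤ (∑ x ∈ (univ : Finset α).offDiag,
        (((Fintype.piFinset I).filter fun f => f x.1 = f x.2).card : ℝ)) * X := by
        gcongr
        exact_mod_cast (card_le_card hsub).trans card_biUnion_le
    _ ≤ ∑ _x ∈ (univ : Finset α).offDiag, 2 ^ Fintype.card α * ∏ a, d a := by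
        rw [sum_mul]
        exact sum_le_sum hone
    _ = (univ : Finset α).offDiag.card * (2 ^ Fintype.card α * ∏ a, d a) := by
        rw [sum_const, nsmul_eq_mul]
    _ ≤ (Fintype.card α) ^ 2 * (2 ^ Fintype.card α * ∏ a, d a) := by
        gcongr
        rw [offDiag_card, card_univ, sq]
        exact_mod_cast Nat.sub_le _ _
    _ = _ := by ring

lemma prod_smallPrimes_eulerFactor_le (H : Finset ℕ) {K r : ℕ} (hK : K ≤ r) (Y : ℕ) :
    ∏ p ∈ smallPrimes Y, eulerFactor H K p ≤ 2 ^ (r * Y) := by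
  have hcard : (smallPrimes Y).card ≤ Y := by
    have : (smallPrimes Y).map ⟨fun p : Nat.Primes => (p : ℕ), Subtype.val_injective⟩ ⊆
        Icc 1 Y := by
      intro n hn
      obtain ⟨p, hp, rfl⟩ := mem_map.1 hn
      exact mem_Icc.2 ⟨p.2.one_le, mem_smallPrimes.1 hp⟩
    simpa using card_le_card this
  calc _ ≤ ∏ _p ∈ smallPrimes Y, (2 : ℝ) ^ K :=
        prod_le_prod (fun p _ => eulerFactor_nonneg H K p.2.two_le)
          fun p _ => eulerFactor_le H K p.2.two_le
    _ = 2 ^ (K * (smallPrimes Y).card) := by rw [prod_const, pow_mul]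
    _ ≤ 2 ^ (r * Y) := pow_le_pow_right₀ one_le_two (Nat.mul_le_mul hK hcard)

/-- The average of the singular series over a set of tuples which contains all injective tuples
of a box, given a bound `E` for the relative error made by truncating the series at `Y`. -/
lemma abs_sum_singSeries_image_sub_le {α : Type*} [Fintype α] [DecidableEq α] (Y : ℕ)
    (B C : α → ℝ) (hB : ∀ a, 0 ≤ B a) {h X E : ℝ} (hX : 1 ≤ X) (hP : (primorial Y : ℝ) ≤ X)
    (hXY : (2 : ℝ) ^ (Fintype.card α * Y) ≤ X) (hd : ∀ a, X ^ 2 ≤ C a - B a)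
    (hC : ∀ a, C a ≤ h) (hE0 : 0 ≤ E) (hE1 : E ≤ 1)
    (hE : ∀ H : Finset ℕ, H.card ≤ Fintype.card α → (∀ x ∈ H, (x : ℝ) ≤ h) →
      |singSeries H - ∏ p ∈ smallPrimes Y, eulerFactor H H.card p| ≤
        E * ∏ p ∈ smallPrimes Y, eulerFactor H H.card p)
    (J : Finset (α → ℕ)) (hJ : J ⊆ Fintype.piFinset fun a => Icc ⌈B a⌉₊ ⌊C a⌋₊)
    (hJinj : ∀ f ∈ Fintype.piFinset (fun a => Icc ⌈B a⌉₊ ⌊C a⌋₊), Function.Injective f → f ∈ J) :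
    |∑ f ∈ J, singSeries (univ.image f) - ∏ a, (C a - B a)| ≤
      (∏ a, (C a - B a)) * (E + (1 + E) * (Real.exp (Fintype.card α * (2 / X)) - 1) +
        3 * ((Fintype.card α) ^ 2 * 2 ^ Fintype.card α) / X) := by
  classical
  set box := Fintype.piFinset fun a => Icc ⌈B a⌉₊ ⌊C a⌋₊ with hbox
  set D := ∏ a, (C a - B a) with hD
  set r := Fintype.card α with hr
  set τ := Real.exp (r * (2 / X)) - 1 with hτ
  have hX0 : 0 < X := by linarith
  have hW := abs_sum_truncSeries_sub_le Y B C hB hX0 hP hd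
  set W := ∑ f ∈ box, truncSeries Y f with hWdef
  have hterm : ∀ f ∈ box, |(if f ∈ J then singSeries (univ.image f) else 0) - truncSeries Y f| ≤
      E * truncSeries Y f + if Function.Injective f then 0 else 3 * X := by
    intro f hf
    have hH : ∀ x ∈ univ.image f, (x : ℝ) ≤ h := by
      intro x hx
      obtain ⟨a, -, rfl⟩ := mem_image.1 hx
      have h1 := (mem_Icc.1 (Fintype.mem_piFinset.1 hf a)).2
      have hCa : 0 ≤ C a := by nlinarith [hd a, hB a, sq_nonneg X]
      exact ((Nat.le_floor_iff hCa).1 h1).trans (hC a)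
    have hcard : (univ.image f).card ≤ r := card_image_le.trans_eq card_univ
    have hmain := hE _ hcard hH
    have hG0 := truncSeries_nonneg Y f
    split_ifs with hfJ hinj hinj
    · have : (univ.image f).card = r := by rw [card_image_of_injective _ hinj, card_univ]
      rw [this] at hmain
      rw [add_zero]
      exact hmain
    · have hG := (prod_smallPrimes_eulerFactor_le (univ.image f) le_rfl Y).trans hXY
      have hS := (prod_smallPrimes_eulerFactor_le (univ.image f) hcard Y).trans hXY
      have hS0 : 0 ≤ ∏ p ∈ smallPrimes Y, eulerFactor (univ.image f) (univ.image f).card p :=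
        prod_nonneg fun p _ => eulerFactor_nonneg _ _ p.2.two_le
      change truncSeries Y f ≤ X at hG
      rw [abs_le] at hmain ⊢
      constructor <;> nlinarith [mul_nonneg hE0 hG0]
    · exact absurd (hJinj f hf hinj) hfJ
    · have hG := (prod_smallPrimes_eulerFactor_le (univ.image f) le_rfl Y).trans hXY
      change truncSeries Y f ≤ X at hG
      rw [zero_sub, abs_neg, abs_of_nonneg hG0]
      nlinarith [mul_nonneg hE0 hG0]
  set Q : ℝ := ((box.filter fun f => ¬ Function.Injective f).card : ℝ) with hQ
  have hJW : |∑ f ∈ J, singSeries (univ.image f) - W| ≤ E * W + 3 * (Q * X) := by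
    have h1 : ∑ f ∈ J, singSeries (univ.image f) =
        ∑ f ∈ box, if f ∈ J then singSeries (univ.image f) else 0 := by
      rw [← sum_filter, filter_mem_eq_inter, inter_eq_right.2 hJ]
    rw [h1, hWdef, ← sum_sub_distrib]
    refine (abs_sum_le_sum_abs _ _).trans ((sum_le_sum hterm).trans_eq ?_)
    rw [sum_add_distrib, ← mul_sum, sum_ite, sum_const_zero, zero_add, sum_const, nsmul_eq_mul]
    ring
  have hQX : Q * X ^ 2 ≤ r ^ 2 * 2 ^ r * D := by
    refine card_piFinset_filter_not_injective_le _ (fun a => C a - B a) (one_le_pow₀ hX) hd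
      fun a => ?_
    have hBC : B a ≤ C a := by nlinarith [hd a]
    have h1 := Nat.le_ceil (B a)
    have h2 := Nat.floor_le ((hB a).trans hBC)
    rw [Nat.card_Icc]
    rcases le_total ⌈B a⌉₊ (⌊C a⌋₊ + 1) with h3 | h3
    · rw [Nat.cast_sub h3]
      push_cast
      linarith
    · rw [Nat.sub_eq_zero_of_le h3, Nat.cast_zero]
      linarith
  have hQX' : Q * X ≤ r ^ 2 * 2 ^ r * D / X := by
    rw [le_div_iff₀ hX0]
    linarith [hQX, (by ring : Q * X * X = Q * X ^ 2)]
  have hWle : W ≤ D * (1 + τ) := by linarith [(abs_le.1 hW).2]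
  have hEW := mul_le_mul_of_nonneg_left hWle hE0
  calc _ ≤ _ := abs_sub_le _ W _
    _ ≤ (E * (D * (1 + τ)) + 3 * (r ^ 2 * 2 ^ r * D / X)) + D * τ := by linarith
    _ = _ := by ring

/-- The truncation level `Y = ⌊c log h⌋` makes the tail of the singular series close to `1`. -/
lemma tail_bound_le {r : ℕ} {c L : ℝ} (hc0 : 0 < c) (hc1 : c ≤ 1) (hL : 4 / c ^ 2 ≤ L) :
    2 ≤ ⌊c * L⌋₊ ∧
    2 ^ r * (r * (r ^ 2 * L / Real.log ⌊c * L⌋₊ / ⌊c * L⌋₊) + r ^ 2 * (1 / (⌊c * L⌋₊ : ℝ))) ≤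
      2 ^ r * (4 * r ^ 3 + 2 * r ^ 2) / c / Real.log L := by
  have hL' : 4 ≤ L * c ^ 2 := (div_le_iff₀ (by positivity)).1 hL
  have hL0 : 0 < L := lt_of_lt_of_le (by positivity) hL
  have hcL4 : 4 ≤ c * L := by nlinarith [mul_nonneg (mul_pos hc0 hL0).le (sub_nonneg.2 hc1)]
  have hL4 : 4 ≤ L := by nlinarith
  set Y := ⌊c * L⌋₊ with hYdef
  have hY1 : c * L - 1 < Y := Nat.sub_one_lt_floor _
  have hY : c * L / 2 ≤ Y := by linarith
  have hY2 : (2 : ℝ) ≤ Y := by linarith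
  refine ⟨by exact_mod_cast hY2, ?_⟩
  have hlogL : 0 < Real.log L := Real.log_pos (by linarith)
  have hlogY : Real.log L / 2 ≤ Real.log Y := by
    have h1 : L ≤ (Y : ℝ) ^ 2 := by nlinarith
    have h2 := Real.log_le_log (by linarith) h1
    rw [Real.log_pow] at h2
    push_cast at h2
    linarith
  have hlogY0 : 0 < Real.log Y := by linarith
  have hlogLL : Real.log L ≤ L := by linarith [Real.log_le_sub_one_of_pos (by linarith : 0 < L)]
  have h1 : L / Real.log Y / Y ≤ 4 / c / Real.log L := by
    calc L / Real.log Y / Y ≤ L / (Real.log L / 2) / (c * L / 2) := by gcongr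
      _ = 4 / c / Real.log L := by
        field_simp
        norm_num
  have h2 : 1 / (Y : ℝ) ≤ 2 / c / Real.log L := by
    calc 1 / (Y : ℝ) ≤ 1 / (c * Real.log L / 2) := by
          apply one_div_le_one_div_of_le (by positivity)
          nlinarith
      _ = 2 / c / Real.log L := by field_simp
  calc _ = 2 ^ r * (r ^ 3 * (L / Real.log Y / Y) + r ^ 2 * (1 / (Y : ℝ))) := by ring
    _ ≤ 2 ^ r * (r ^ 3 * (4 / c / Real.log L) + r ^ 2 * (2 / c / Real.log L)) := by gcongr
    _ = _ := by ring

lemma exp_sub_one_le_two_mul {x : ℝ} (h0 : 0 ≤ x) (h1 : x ≤ 1) : Real.exp x - 1 ≤ 2 * x := by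
  have := Real.abs_exp_sub_one_le (x := x) (by rwa [abs_of_nonneg h0])
  rw [abs_of_nonneg h0] at this
  exact (le_abs_self _).trans this

/-- The choice of the truncation level `Y`, of a bound `X` for the moduli and of a bound `E` for the
tails of the singular series. -/
lemma exists_truncation_parameters (r : ℕ) {δ : ℝ} (hδ0 : 0 < δ) (hδ1 : δ < 1) :
    ∃ C h₀ : ℝ, 0 < C ∧ 3 ≤ h₀ ∧ ∀ h : ℝ, h₀ ≤ h → ∃ (Y : ℕ) (X E : ℝ), 1 ≤ X ∧
      X ^ 2 = h ^ δ ∧ (primorial Y : ℝ) ≤ X ∧ (2 : ℝ) ^ (r * Y) ≤ X ∧ 0 ≤ E ∧ E ≤ 1 ∧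
      (∀ H : Finset ℕ, H.card ≤ r → (∀ x ∈ H, (x : ℝ) ≤ h) →
        |singSeries H - ∏ p ∈ smallPrimes Y, eulerFactor H H.card p| ≤
          E * ∏ p ∈ smallPrimes Y, eulerFactor H H.card p) ∧
      E + (1 + E) * (Real.exp (r * (2 / X)) - 1) + 3 * (r ^ 2 * 2 ^ r) / X ≤
        C * (1 / Real.log (Real.log h)) := by
  obtain ⟨c, hc⟩ : ∃ c : ℝ, c = δ / (4 * (r + 1)) := ⟨_, rfl⟩
  have hr0 : (0 : ℝ) ≤ r := r.cast_nonneg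
  have hc0 : 0 < c := hc ▸ by positivity
  have hcδ : c * (4 * (r + 1)) = δ := hc ▸ div_mul_cancel₀ _ (by positivity)
  have hc1 : c ≤ 1 := by nlinarith
  set κ : ℝ := 2 ^ r * (4 * r ^ 3 + 2 * r ^ 2) / c with hκ
  have hκ0 : 0 ≤ κ := by positivity
  set M : ℝ := 4 / c ^ 2 + 2 * κ + 8 * r / δ + 1 with hM
  have hM1 : 0 ≤ 4 / c ^ 2 := by positivity
  have hM2 : 0 ≤ 8 * r / δ := by positivity
  refine ⟨4 * κ + (8 * r + 3 * (r ^ 2 * 2 ^ r)) * (2 / δ) + 1, Real.exp (Real.exp M),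
    by positivity, ?_, ?_⟩
  · linarith [Real.add_one_le_exp (Real.exp M), Real.add_one_le_exp M]
  intro h hh
  have hh0 : 0 < h := (Real.exp_pos _).trans_le hh
  set L := Real.log h with hL
  have hML : Real.exp M ≤ L := (Real.le_log_iff_exp_le hh0).2 hh
  have hL0 : 0 < L := (Real.exp_pos _).trans_le hML
  have hMlogL : M ≤ Real.log L := (Real.le_log_iff_exp_le hL0).2 hML
  have hlogL : 0 < Real.log L := by linarith
  have hlogLL : Real.log L ≤ L := by linarith [Real.log_le_sub_one_of_pos hL0]
  have h1 : 1 ≤ h := by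
    rw [← Real.exp_log hh0]
    exact Real.one_le_exp hL0.le
  set X : ℝ := Real.exp (δ / 2 * L) with hX
  have hXδ : X ^ 2 = h ^ δ := by
    rw [Real.rpow_def_of_pos hh0, hX, ← Real.exp_nat_mul]
    congr 1
    push_cast
    ring
  have hX1 : 1 ≤ X := Real.one_le_exp (by positivity)
  have hX0 : 0 < X := by linarith
  have hXlog : δ / 2 * Real.log L ≤ X := by
    have := Real.add_one_le_exp (δ / 2 * L)
    nlinarith
  have hXinv : 1 / X ≤ 2 / δ * (1 / Real.log L) := by
    rw [div_mul_div_comm, div_le_div_iff₀ hX0 (by positivity)]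
    linarith
  have hXr : r * (2 / X) ≤ 1 / 2 := by
    have h8 : 8 * r ≤ δ * Real.log L := by
      have : 8 * r / δ ≤ Real.log L := by linarith
      rw [div_le_iff₀ hδ0] at this
      linarith
    rw [mul_div_assoc', div_le_iff₀ hX0]
    linarith
  obtain ⟨hY2, hη⟩ := tail_bound_le (r := r) hc0 hc1 (by linarith : 4 / c ^ 2 ≤ L)
  have hYL : (⌊c * L⌋₊ : ℝ) ≤ c * L := Nat.floor_le (by positivity)
  set Y := ⌊c * L⌋₊ with hY
  set η : ℝ := 2 ^ r * (r * (r ^ 2 * L / Real.log Y / Y) + r ^ 2 * (1 / (Y : ℝ))) with hηdef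
  have hη0 : 0 ≤ η := by
    have : 0 ≤ Real.log Y := Real.log_natCast_nonneg Y
    positivity
  have hη1 : η ≤ 1 / 2 := by
    refine hη.trans ?_
    rw [div_le_iff₀ hlogL]
    linarith
  have hδL : δ / 2 * L = 2 * (r * (c * L)) + 2 * (c * L) := by linear_combination (-L / 2) * hcδ
  have hcL : 0 ≤ c * L := by positivity
  have hP : (primorial Y : ℝ) ≤ X := by
    calc (primorial Y : ℝ) ≤ (4 : ℝ) ^ Y := by exact_mod_cast primorial_le_four_pow Y
      _ ≤ (Real.exp 2) ^ Y := by
        gcongr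
        have := Real.exp_one_gt_d9
        rw [show (2 : ℝ) = 1 + 1 by norm_num, Real.exp_add]
        nlinarith
      _ = Real.exp (Y * 2) := (Real.exp_nat_mul 2 Y).symm
      _ ≤ X := by
        refine Real.exp_le_exp.2 ?_
        linarith [mul_nonneg hr0 hcL]
  have hXY : (2 : ℝ) ^ (r * Y) ≤ X := by
    calc (2 : ℝ) ^ (r * Y) ≤ (Real.exp 1) ^ (r * Y) := by
          gcongr
          linarith [Real.exp_one_gt_d9]
      _ = Real.exp ((r * Y : ℕ) * 1) := (Real.exp_nat_mul 1 _).symm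
      _ ≤ X := by
        refine Real.exp_le_exp.2 ?_
        push_cast
        linarith [mul_nonneg hr0 hcL, mul_le_mul_of_nonneg_left hYL hr0]
  have hE0 : 0 ≤ Real.exp η - 1 := by linarith [Real.add_one_le_exp η]
  have hE2 := exp_sub_one_le_two_mul hη0 (by linarith)
  have hτ2 := exp_sub_one_le_two_mul (by positivity : 0 ≤ r * (2 / X)) (by linarith)
  refine ⟨Y, X, Real.exp η - 1, hX1, hXδ, hP, hXY, hE0, by linarith, fun H hH1 hH2 =>
    abs_singSeries_sub_le H Y η fun s hs =>
      sum_abs_eulerFactor_sub_one_le H hH1 h1 hH2 hY2 s hs, ?_⟩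
  have e1 : η ≤ κ * (1 / Real.log L) := by rw [mul_one_div]; exact hη
  have e2 : (1 + (Real.exp η - 1)) * (Real.exp (r * (2 / X)) - 1) ≤ 2 * (4 * r * (1 / X)) := by
    refine mul_le_mul (by linarith) (hτ2.trans_eq (by ring)) ?_ (by norm_num)
    linarith [Real.one_le_exp (by positivity : 0 ≤ r * (2 / X))]
  have e3 : (8 * r + 3 * (r ^ 2 * 2 ^ r)) * (1 / X) ≤
      (8 * r + 3 * (r ^ 2 * 2 ^ r)) * (2 / δ * (1 / Real.log L)) :=
    mul_le_mul_of_nonneg_left hXinv (by positivity)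
  have e4 : 0 ≤ 1 / Real.log L := by positivity
  have e5 := mul_nonneg hκ0 e4
  have e6 : 3 * (r ^ 2 * 2 ^ r) / X = 3 * ((r : ℝ) ^ 2 * 2 ^ r) * (1 / X) := by ring
  rw [e6]
  linarith

/-- Theorem 2 of the paper: the average of the singular series over tuples of sets drawn
from subintervals of [0,h] whose lengths are at least h^δ. -/
theorem singular_series_average (l : ℕ) (hl : 1 ≤ l) (k : Fin l → ℕ) (hk : ∀ i, 0 < k i)
    (r : ℕ) (hr : r = ∑ i, k i) (δ : ℝ) (hδ0 : 0 < δ) (hδ1 : δ < 1) :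
    ∃ C h₀ : ℝ, 0 < C ∧ 3 ≤ h₀ ∧
      ∀ h : ℝ, h₀ ≤ h → ∀ B Cv : Fin l → ℝ,
        (∀ i, 0 ≤ B i) → (∀ i, Cv i ≤ h) → (∀ i, h ^ δ ≤ Cv i - B i) →
        |(∑ A ∈ Fintype.piFinset (fun i =>
              (Finset.Icc ⌈B i⌉₊ ⌊Cv i⌋₊).powerset.filter (fun s => s.card = k i)),
            singSeries (Finset.univ.biUnion A)) -
          ∏ i, (Cv i - B i) ^ (k i) / (Nat.factorial (k i) : ℝ)| ≤
          C * (∏ i, (Cv i - B i) ^ (k i) / (Nat.factorial (k i) : ℝ)) *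
            (1 / Real.log (Real.log h)) := by
  obtain ⟨C, h₀, hC, hh₀, hpar⟩ := exists_truncation_parameters r hδ0 hδ1
  refine ⟨C, h₀, hC, hh₀, fun h hh B Cv hB hCv hd => ?_⟩
  obtain ⟨Y, X, E, hX1, hXδ, hP, hXY, hE0, hE1, hE, herr⟩ := hpar h hh
  have hXd : ∀ i, X ^ 2 ≤ Cv i - B i := fun i => hXδ ▸ hd i
  have hcard : Fintype.card (Σ i, Fin (k i)) = r := by simp [hr]
  have key := abs_sum_singSeries_image_sub_le (α := Σ i, Fin (k i)) Y (fun a => B a.1)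
    (fun a => Cv a.1) (fun a => hB a.1) (h := h) (X := X) (E := E) hX1 hP
    (by rwa [hcard]) (fun a => hXd a.1) (fun a => hCv a.1) hE0 hE1 (by rwa [hcard])
    ((Fintype.piFinset fun a : Σ i, Fin (k i) => Icc ⌈B a.1⌉₊ ⌊Cv a.1⌋₊).filter
      (fun f => ∀ i, Function.Injective fun j => f ⟨i, j⟩))
    (filter_subset _ _) (fun f hf hinj => mem_filter.2 ⟨hf, fun i => hinj.comp
      sigma_mk_injective⟩)
  rw [← prod_factorial_mul_sum_biUnion k (fun i => Icc ⌈B i⌉₊ ⌊Cv i⌋₊) singSeries,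
    hcard] at key
  have hprod : ∏ a : Σ i, Fin (k i), (Cv a.1 - B a.1) = ∏ i, (Cv i - B i) ^ k i := by
    rw [Fintype.prod_sigma]
    simp
  rw [hprod] at key
  set S := ∑ A ∈ Fintype.piFinset (fun i =>
    (Finset.Icc ⌈B i⌉₊ ⌊Cv i⌋₊).powerset.filter (fun s => s.card = k i)),
      singSeries (Finset.univ.biUnion A) with hS
  set F : ℝ := ((∏ i, (k i).factorial : ℕ) : ℝ) with hF
  set D := ∏ i, (Cv i - B i) ^ k i with hD
  have hF0 : 0 < F := by
    rw [hF]
    exact_mod_cast prod_pos fun i _ => (k i).factorial_pos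
  have hDF : ∏ i, (Cv i - B i) ^ k i / ((k i).factorial : ℝ) = D / F := by
    rw [prod_div_distrib, hF]
    push_cast
    rfl
  have hD0 : 0 ≤ D := prod_nonneg fun i _ => pow_nonneg (by nlinarith [hXd i]) _
  rw [hDF, show S - D / F = (F * S - D) / F by field_simp, abs_div, abs_of_pos hF0,
    div_le_iff₀ hF0]
  refine key.trans ((mul_le_mul_of_nonneg_left herr hD0).trans_eq ?_)
  field_simp
end

section
/- For every M ∈ ℕ there exist constants C = C(M) > 0 and C_M > 0 such that for every real R ≥ 3, every positive integer h, all sets H₁, H₂, H₃, H₄ ⊆ {1,…,h} with |Hᵢ| = kᵢ, and all integers l₁,…,l₄ ≥ 0 with Σᵢ(kᵢ + lᵢ) ≤ M: Σ_{d₁,d₂,d₃,d₄ ≤ R, each dᵢ squarefree} Φ(d₁,d₂,d₃,d₄)·∏ᵢ₌₁⁴ |λ_R(dᵢ; kᵢ+lᵢ)| ≤ C·R⁴·(log R)^{C_M}. -/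
open Finset

/-- |⋂_{i : p | dᵢ} Ω_{Hᵢ}(p)|, where an empty intersection (no i with p | dᵢ) is taken
over all residues mod p, contributing p. -/
def interCard (H : Fin 4 → Finset ℕ) (T : Finset (Fin 4)) (p : ℕ) : ℕ :=
  ((Finset.range p).filter (fun a => ∀ t ∈ T, a ∈ (H t).image (fun x => x % p))).card

/-- Φ(d₁,d₂,d₃,d₄) = ∏_{p | d₁d₂d₃d₄} |⋂_{i : p | dᵢ} Ω_{Hᵢ}(p)| for squarefree dᵢ. -/
def Phi (H : Fin 4 → Finset ℕ) (d : Fin 4 → ℕ) : ℕ :=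
  ∏ p ∈ (d 0 * d 1 * d 2 * d 3).primeFactors,
    interCard H (Finset.univ.filter (fun i => p ∣ d i)) p

/-- λ_R(d; a) = μ(d)(log(R/d))^a / a! for d ≤ R, and 0 for d > R. -/
noncomputable def lamWeight (R : ℝ) (d : ℕ) (a : ℕ) : ℝ :=
  if (d : ℝ) ≤ R then
    (1 / (Nat.factorial a : ℝ)) * (ArithmeticFunction.moebius d : ℝ) *
      (Real.log (R / d)) ^ a
  else 0

theorem interCard_le_card (H : Fin 4 → Finset ℕ) {T : Finset (Fin 4)} {t : Fin 4} (ht : t ∈ T)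
    (p : ℕ) : interCard H T p ≤ (H t).card := by
  refine le_trans (card_le_card (t := (H t).image (fun x => x % p)) ?_) card_image_le
  intro a ha
  exact (mem_filter.mp ha).2 t ht

theorem Phi_le_prod_pow (H : Fin 4 → Finset ℕ) {K : ℕ} (hK : 1 ≤ K) (hH : ∀ i, (H i).card ≤ K)
    (d : Fin 4 → ℕ) : Phi H d ≤ ∏ i, K ^ (d i).primeFactors.card := by
  have hsub : (d 0 * d 1 * d 2 * d 3).primeFactors ⊆ univ.biUnion fun i => (d i).primeFactors := by
    intro p hp
    rw [← Fin.prod_univ_four, Nat.mem_primeFactors] at hp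
    obtain ⟨hp, hdvd, hne⟩ := hp
    obtain ⟨i, -, hi⟩ := (hp.prime.dvd_finsetProd_iff d).mp hdvd
    exact mem_biUnion.mpr ⟨i, mem_univ i,
      Nat.mem_primeFactors.mpr ⟨hp, hi, prod_ne_zero_iff.mp hne i (mem_univ i)⟩⟩
  have hfactor : ∀ p ∈ (d 0 * d 1 * d 2 * d 3).primeFactors,
      interCard H (univ.filter fun i => p ∣ d i) p ≤ K := by
    intro p hp
    obtain ⟨i, -, hi⟩ := mem_biUnion.mp (hsub hp)
    exact (interCard_le_card H
      (mem_filter.mpr ⟨mem_univ i, Nat.dvd_of_mem_primeFactors hi⟩) p).trans (hH i)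
  calc Phi H d ≤ K ^ (d 0 * d 1 * d 2 * d 3).primeFactors.card := prod_le_pow_card _ _ _ hfactor
    _ ≤ K ^ ∑ i, (d i).primeFactors.card :=
        Nat.pow_le_pow_right hK ((card_le_card hsub).trans card_biUnion_le)
    _ = ∏ i, K ^ (d i).primeFactors.card := (prod_pow_eq_pow_sum _ _ _).symm

theorem abs_lamWeight_le {R : ℝ} (hR : 1 ≤ R) {d : ℕ} (hd : 1 ≤ d) (a : ℕ) :
    |lamWeight R d a| ≤ Real.log R ^ a := by
  have hlogR : 0 ≤ Real.log R := Real.log_nonneg hR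
  unfold lamWeight
  split_ifs with h
  · have hd' : (1 : ℝ) ≤ d := by exact_mod_cast hd
    have hlog : 0 ≤ Real.log (R / d) := Real.log_nonneg ((one_le_div (by linarith)).mpr h)
    have hlog' : Real.log (R / d) ≤ Real.log R :=
      Real.log_le_log (by positivity) (div_le_self (by linarith) hd')
    have hmu : |(ArithmeticFunction.moebius d : ℝ)| ≤ 1 := by
      exact_mod_cast ArithmeticFunction.abs_moebius_le_one (n := d)
    have hfact : |1 / (a.factorial : ℝ)| ≤ 1 := by
      rw [abs_of_nonneg (by positivity)]
      exact div_le_one_of_le₀ (by exact_mod_cast a.factorial_pos) (by positivity)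
    rw [abs_mul, abs_mul, abs_of_nonneg (pow_nonneg hlog a)]
    calc |1 / (a.factorial : ℝ)| * |(ArithmeticFunction.moebius d : ℝ)| * Real.log (R / d) ^ a
        ≤ 1 * 1 * Real.log R ^ a := by gcongr
      _ = Real.log R ^ a := by ring
  · simpa using pow_nonneg hlogR a

theorem sum_pow_card_primeFactors_div_le (K N : ℕ) :
    ∑ n ∈ (Icc 1 N).filter (fun n => Squarefree n), (K : ℝ) ^ n.primeFactors.card / n ≤
      (∑ n ∈ Icc 1 N, (n : ℝ)⁻¹) ^ K := by
  have hfiber : ∀ n ∈ (Icc 1 N).filter (fun n => Squarefree n),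
      (K : ℝ) ^ n.primeFactors.card / n ≤
        ∑ f ∈ Fintype.piFinset (fun _ : Fin K => Icc 1 N) with ∏ i, f i = n,
          ∏ i, (f i : ℝ)⁻¹ := by
    intro n hn
    obtain ⟨hn, hsq⟩ := mem_filter.mp hn
    have hcard : (Nat.finMulAntidiag K n).card = K ^ n.primeFactors.card := by
      rw [Nat.card_finMulAntidiag_of_squarefree hsq]
      rfl
    have hsub : Nat.finMulAntidiag K n ⊆
        {f ∈ Fintype.piFinset (fun _ : Fin K => Icc 1 N) | ∏ i, f i = n} := by
      intro f hf
      refine mem_filter.mpr ⟨Fintype.mem_piFinset.mpr fun i => ?_,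
        Nat.prod_eq_of_mem_finMulAntidiag hf⟩
      have hdvd := Nat.dvd_of_mem_finMulAntidiag hf i
      have hpos : 0 < n := (mem_Icc.mp hn).1
      exact mem_Icc.mpr ⟨Nat.pos_of_dvd_of_pos hdvd hpos,
        (Nat.le_of_dvd hpos hdvd).trans (mem_Icc.mp hn).2⟩
    calc (K : ℝ) ^ n.primeFactors.card / n
        = ∑ f ∈ Nat.finMulAntidiag K n, (n : ℝ)⁻¹ := by
          rw [sum_const, hcard, nsmul_eq_mul, div_eq_mul_inv]
          push_cast
          rfl
      _ = ∑ f ∈ Nat.finMulAntidiag K n, ∏ i, (f i : ℝ)⁻¹ := by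
          refine sum_congr rfl fun f hf => ?_
          rw [prod_inv_distrib, ← Nat.cast_prod, Nat.prod_eq_of_mem_finMulAntidiag hf]
      _ ≤ _ := sum_le_sum_of_subset_of_nonneg hsub fun f _ _ => by positivity
  calc _ ≤ _ := sum_le_sum hfiber
    _ ≤ ∑ f ∈ Fintype.piFinset (fun _ : Fin K => Icc 1 N), ∏ i, (f i : ℝ)⁻¹ :=
        sum_fiberwise_le_sum_of_sum_fiber_nonneg fun n _ =>
          sum_nonneg fun f _ => by positivity
    _ = (∑ n ∈ Icc 1 N, (n : ℝ)⁻¹) ^ K := by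
        rw [← prod_univ_sum (fun _ : Fin K => Icc 1 N) (fun _ n => (n : ℝ)⁻¹)]
        simp

theorem sum_pow_card_primeFactors_le (K : ℕ) {R : ℝ} (hR : 1 ≤ R) :
    ∑ n ∈ (Icc 1 ⌊R⌋₊).filter (fun n => Squarefree n), (K : ℝ) ^ n.primeFactors.card ≤
      R * (1 + Real.log R) ^ K := by
  have hR₀ : 0 ≤ R := by linarith
  have hharm : ∑ n ∈ Icc 1 ⌊R⌋₊, (n : ℝ)⁻¹ ≤ 1 + Real.log R := by
    have h := harmonic_floor_le_one_add_log R hR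
    rw [harmonic_eq_sum_Icc] at h
    push_cast at h
    exact h
  calc ∑ n ∈ (Icc 1 ⌊R⌋₊).filter (fun n => Squarefree n), (K : ℝ) ^ n.primeFactors.card
      ≤ ∑ n ∈ (Icc 1 ⌊R⌋₊).filter (fun n => Squarefree n),
          R * ((K : ℝ) ^ n.primeFactors.card / n) := by
        refine sum_le_sum fun n hn => ?_
        obtain ⟨hn₁, hn₂⟩ := mem_Icc.mp (mem_filter.mp hn).1
        have hpos : (0 : ℝ) < n := by exact_mod_cast hn₁
        have hle : (n : ℝ) ≤ R := (Nat.le_floor_iff hR₀).mp hn₂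
        rw [mul_div_assoc', le_div_iff₀ hpos, mul_comm]
        gcongr
    _ ≤ R * (∑ n ∈ Icc 1 ⌊R⌋₊, (n : ℝ)⁻¹) ^ K := by
        rw [← mul_sum]
        exact mul_le_mul_of_nonneg_left (sum_pow_card_primeFactors_div_le K _) hR₀
    _ ≤ R * (1 + Real.log R) ^ K := by gcongr

/-- The first error term of Theorem 1: the full sum of Φ against the |λ_R| weights is
O(R⁴ (log R)^{C_M}). -/
theorem first_error_bound (M : ℕ) :
    ∃ C CM : ℝ, 0 < C ∧ 0 < CM ∧
      ∀ (R : ℝ) (h : ℕ) (H : Fin 4 → Finset ℕ) (l : Fin 4 → ℕ),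
        3 ≤ R → 0 < h → (∀ i, H i ⊆ Finset.Icc 1 h) →
        (∑ i, ((H i).card + l i)) ≤ M →
        (∑ d ∈ Fintype.piFinset
            (fun _ : Fin 4 => (Finset.Icc 1 ⌊R⌋₊).filter (fun n => Squarefree n)),
          (Phi H d : ℝ) * ∏ i, |lamWeight R (d i) ((H i).card + l i)|) ≤
        C * R ^ 4 * (Real.log R) ^ CM := by
  refine ⟨2 ^ (4 * (M + 1)), ((M + 4 * (M + 1) : ℕ) : ℝ), by positivity, by positivity, ?_⟩
  intro R h H l hR _ _ hM
  have hR₁ : 1 ≤ R := by linarith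
  have hlog : 1 ≤ Real.log R := by
    rw [Real.le_log_iff_exp_le (by linarith)]
    linarith [Real.exp_one_lt_d9]
  have hH : ∀ i, (H i).card ≤ M + 1 := fun i => by
    have := single_le_sum (f := fun i => (H i).card + l i) (fun _ _ => Nat.zero_le _) (mem_univ i)
    omega
  set S := (Icc 1 ⌊R⌋₊).filter (fun n => Squarefree n)
  have hterm : ∀ d ∈ Fintype.piFinset (fun _ : Fin 4 => S),
      (Phi H d : ℝ) * ∏ i, |lamWeight R (d i) ((H i).card + l i)| ≤
        (∏ i, ((M + 1 : ℕ) : ℝ) ^ (d i).primeFactors.card) * Real.log R ^ M := by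
    intro d hd
    have hPhi : (Phi H d : ℝ) ≤ ∏ i, ((M + 1 : ℕ) : ℝ) ^ (d i).primeFactors.card := by
      exact_mod_cast Phi_le_prod_pow H (Nat.le_add_left 1 M) hH d
    have hlam : ∏ i, |lamWeight R (d i) ((H i).card + l i)| ≤ Real.log R ^ M :=
      calc ∏ i, |lamWeight R (d i) ((H i).card + l i)|
          ≤ ∏ i, Real.log R ^ ((H i).card + l i) :=
            prod_le_prod (fun _ _ => abs_nonneg _) fun i _ => abs_lamWeight_le hR₁
              (mem_Icc.mp (mem_filter.mp (Fintype.mem_piFinset.mp hd i)).1).1 _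
        _ = Real.log R ^ ∑ i, ((H i).card + l i) := prod_pow_eq_pow_sum _ _ _
        _ ≤ Real.log R ^ M := pow_le_pow_right₀ hlog hM
    exact mul_le_mul hPhi hlam (prod_nonneg fun _ _ => abs_nonneg _) (by positivity)
  calc _ ≤ _ := sum_le_sum hterm
    _ = (∑ n ∈ S, ((M + 1 : ℕ) : ℝ) ^ n.primeFactors.card) ^ 4 * Real.log R ^ M := by
        rw [← sum_mul, ← prod_univ_sum (fun _ : Fin 4 => S)
          (fun _ n => ((M + 1 : ℕ) : ℝ) ^ n.primeFactors.card), prod_const, card_fin]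
    _ ≤ (R * (2 * Real.log R) ^ (M + 1)) ^ 4 * Real.log R ^ M := by
        gcongr
        refine (sum_pow_card_primeFactors_le (M + 1) hR₁).trans ?_
        gcongr
        linarith
    _ = 2 ^ (4 * (M + 1)) * R ^ 4 * Real.log R ^ ((M + 4 * (M + 1) : ℕ) : ℝ) := by
        rw [Real.rpow_natCast]
        ring
end

section
/- Let N ≥ 2 be an integer and let R, h be reals with 1 < R < N and 1 ≤ h < N. Let n be an integer with N < n ≤ 2N and let h₀, h₁ be distinct integers in [1,h]. Then θ(n+h₀)·θ(n+h₁) ≤ (log 3N)²·(2·Λ_R(n;{h₀,h₁},2)/(log R)²)². -/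
open Finset

/-- θ(n) = log n if n is prime, 0 otherwise. -/
noncomputable def theta (n : ℕ) : ℝ := if Nat.Prime n then Real.log n else 0

/-- If every prime factor of `P(n, H)` exceeds `R`, only `d = 1` contributes to `lamR`. -/
theorem lamR_eq_of_forall_prime_lt {R : ℝ} (hR : 1 ≤ R) {n : ℕ} {H : Finset ℕ}
    (hP : ∏ h ∈ H, (n + h) ≠ 0)
    (hprime : ∀ p : ℕ, p.Prime → p ∣ ∏ h ∈ H, (n + h) → R < p) (a : ℕ) :
    lamR R n H a = (1 / (Nat.factorial a : ℝ)) * Real.log R ^ a := by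
  have hfilter : (∏ h ∈ H, (n + h)).divisors.filter (fun d : ℕ => (d : ℝ) ≤ R) = {1} := by
    ext d
    simp only [mem_filter, Nat.mem_divisors, mem_singleton]
    constructor
    · rintro ⟨⟨hd, -⟩, hdR⟩
      by_contra hd1
      have hlt := hprime d.minFac (Nat.minFac_prime hd1) ((Nat.minFac_dvd d).trans hd)
      have hle : (d.minFac : ℝ) ≤ d := by
        exact_mod_cast Nat.minFac_le (Nat.pos_of_dvd_of_pos hd (Nat.pos_of_ne_zero hP))
      linarith
    · rintro rfl
      exact ⟨⟨one_dvd _, hP⟩, by simpa using hR⟩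
  simp [lamR, hfilter]

/-- θ(n+h₀)·θ(n+h₁) ≤ (log 3N)²·(2 Λ_R(n;{h₀,h₁},2)/(log R)²)². -/
theorem theta_product_le (N : ℕ) (hN : 2 ≤ N) (R h : ℝ)
    (hR1 : 1 < R) (hRN : R < N) (hh1 : 1 ≤ h) (hhN : h < N)
    (n : ℕ) (hn1 : N < n) (hn2 : n ≤ 2 * N)
    (h₀ h₁ : ℕ) (hne : h₀ ≠ h₁) (h₀1 : 1 ≤ h₀) (h₀h : (h₀ : ℝ) ≤ h)
    (h₁1 : 1 ≤ h₁) (h₁h : (h₁ : ℝ) ≤ h) :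
    theta (n + h₀) * theta (n + h₁) ≤
      (Real.log (3 * N)) ^ 2 * (2 * lamR R n {h₀, h₁} 2 / (Real.log R) ^ 2) ^ 2 := by
  by_cases hp : (n + h₀).Prime ∧ (n + h₁).Prime
  · obtain ⟨hp₀, hp₁⟩ := hp
    have hNn : (N : ℝ) < n := by exact_mod_cast hn1
    have hn2N : (n : ℝ) ≤ 2 * N := by exact_mod_cast hn2
    have hprod : ∏ k ∈ ({h₀, h₁} : Finset ℕ), (n + k) = (n + h₀) * (n + h₁) :=
      prod_pair hne
    have hlam : lamR R n {h₀, h₁} 2 = (1 / (Nat.factorial 2 : ℝ)) * Real.log R ^ 2 := by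
      refine lamR_eq_of_forall_prime_lt hR1.le ?_ ?_ 2
      · rw [hprod]
        exact mul_ne_zero hp₀.ne_zero hp₁.ne_zero
      · intro p hp hdvd
        rw [hprod, hp.dvd_mul, Nat.prime_dvd_prime_iff_eq hp hp₀,
          Nat.prime_dvd_prime_iff_eq hp hp₁] at hdvd
        have hnp : (n : ℝ) ≤ p := by
          exact_mod_cast (show n ≤ p by omega)
        linarith
    have hlogR : Real.log R ≠ 0 := (Real.log_pos hR1).ne'
    have hratio : 2 * lamR R n {h₀, h₁} 2 / Real.log R ^ 2 = 1 := by
      rw [hlam]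
      simp only [Nat.factorial_two, Nat.cast_ofNat]
      field_simp
    have log_le : ∀ k : ℕ, (k : ℝ) ≤ h → (n + k).Prime →
        Real.log (n + k : ℕ) ≤ Real.log (3 * N) := by
      intro k hk hpk
      refine Real.log_le_log (by exact_mod_cast hpk.pos) ?_
      push_cast
      linarith
    have hlog₀ := log_le h₀ h₀h hp₀
    rw [hratio, theta, theta, if_pos hp₀, if_pos hp₁, one_pow, mul_one, sq]
    exact mul_le_mul hlog₀ (log_le h₁ h₁h hp₁) (Real.log_natCast_nonneg _)
      ((Real.log_natCast_nonneg _).trans hlog₀)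
  · have hzero : theta (n + h₀) * theta (n + h₁) = 0 := by
      simp only [theta, mul_ite, ite_mul, zero_mul, mul_zero]
      split_ifs <;> simp_all
    rw [hzero]
    positivity
end

section
/- Let H be a finite set of positive integers, let h₀ ∈ H, let n be a positive integer with n > max H, and let R be a real with 1 < R < n + h₀. If n + h₀ is prime, then for every integer a ≥ 0 one has Λ_R(n;H,a) = Λ_R(n;H∖{h₀},a). -/
open Finset

/-- If n + h₀ is prime with h₀ ∈ H and R < n + h₀, then the sieve weight does not see h₀:
Λ_R(n;H,a) = Λ_R(n;H∖{h₀},a). -/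
theorem lamR_erase_of_prime (H : Finset ℕ) (hpos : ∀ x ∈ H, 0 < x)
    (h₀ : ℕ) (hh₀ : h₀ ∈ H) (n : ℕ) (hn : ∀ x ∈ H, x < n)
    (R : ℝ) (hR1 : 1 < R) (hR2 : R < (n : ℝ) + h₀) (hp : Nat.Prime (n + h₀)) (a : ℕ) :
    lamR R n H a = lamR R n (H.erase h₀) a := by
  have hd : (∏ h ∈ H, (n + h)).divisors.filter (fun d : ℕ => (d : ℝ) ≤ R) =
      (∏ h ∈ H.erase h₀, (n + h)).divisors.filter (fun d : ℕ => (d : ℝ) ≤ R) := by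
    have hne : ∀ s ⊆ H, ∏ h ∈ s, (n + h) ≠ 0 := fun s hs =>
      Finset.prod_ne_zero_iff.2 fun x hx => by have := hpos x (hs hx); lia
    ext d
    simp only [Finset.mem_filter, Nat.mem_divisors, hne H subset_rfl,
      hne _ (Finset.erase_subset h₀ H), ne_eq, not_false_eq_true, and_true]
    refine and_congr_left fun hdR => ?_
    rw [← Finset.mul_prod_erase H (fun h => n + h) hh₀]
    refine ⟨fun hdvd => ?_, fun hdvd => hdvd.mul_left _⟩
    have hlt : d < n + h₀ := by exact_mod_cast hdR.trans_lt hR2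
    have hd0 : d ≠ 0 := by
      rintro rfl
      have := hne _ (Finset.erase_subset h₀ H)
      simp_all
    exact (Nat.coprime_of_lt_prime hd0 hlt hp).symm.dvd_of_dvd_mul_left hdvd
  rw [lamR, lamR, hd]
end

section
/- Let k, l, r be integers with l ≥ 0 and 1 ≤ r ≤ k − 3, and let x > 0 be real. Then Σ_{j₁=0}^{3} Σ_{j₂=0}^{3} x^{j₁+j₂}·μ(j₁,j₂,k,l,r) ≤ (2x·(k−r)/r + 1)⁶, and moreover for each pair (j₁,j₂) one has μ(j₁,j₂,k,l,r) ≤ 2^{j₁+j₂}·((k−r)/r)^{j₁+j₂}·C(3,j₁)·C(3,j₂). -/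
open Finset

/-- γ(j,k,r) = (k−r)(k−r−1)⋯(k−r−j+1) (empty product = 1). -/
noncomputable def gammaFun (j k r : ℕ) : ℝ :=
  ∏ i ∈ Finset.range j, ((k : ℝ) - r - i)

/-- β(j₁,j₂,l,r) = (r+2l+1)(r+2l+2)⋯(r+2l+j₁+j₂) (empty product = 1). -/
noncomputable def betaFun (j₁ j₂ l r : ℕ) : ℝ :=
  ∏ i ∈ Finset.range (j₁ + j₂), ((r : ℝ) + 2 * l + 1 + i)

/-- a(j₁,j₂,l) = C(2l+j₁+j₂, l+j₁)/C(2l,l). -/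
noncomputable def aFun (j₁ j₂ l : ℕ) : ℝ :=
  (Nat.choose (2 * l + j₁ + j₂) (l + j₁) : ℝ) / (Nat.choose (2 * l) l : ℝ)

/-- μ(j₁,j₂,k,l,r) = γ(j₁,k,r)γ(j₂,k,r)a(j₁,j₂,l)/β(j₁,j₂,l,r)·C(3,j₁)·C(3,j₂). -/
noncomputable def muFun (j₁ j₂ k l r : ℕ) : ℝ :=
  gammaFun j₁ k r * gammaFun j₂ k r * aFun j₁ j₂ l / betaFun j₁ j₂ l r *
    (Nat.choose 3 j₁ : ℝ) * (Nat.choose 3 j₂ : ℝ)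

theorem choose_two_mul_add_le (l m c : ℕ) :
    (2 * l + m).choose c ≤ 2 ^ m * (2 * l).choose l := by
  induction m generalizing c with
  | zero => simpa [Nat.centralBinom] using Nat.choose_le_centralBinom c l
  | succ m ih =>
    cases c with
    | zero =>
      rw [Nat.choose_zero_right]
      exact Nat.mul_pos (by positivity) (Nat.choose_pos (by lia))
    | succ c =>
      rw [← add_assoc, Nat.choose_succ_succ, pow_succ]
      linarith [ih c, ih (c + 1)]

theorem aFun_nonneg (j₁ j₂ l : ℕ) : 0 ≤ aFun j₁ j₂ l := by
  unfold aFun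
  positivity

theorem aFun_le_two_pow (j₁ j₂ l : ℕ) : aFun j₁ j₂ l ≤ 2 ^ (j₁ + j₂) := by
  have hpos : (0 : ℝ) < (2 * l).choose l := by
    exact_mod_cast Nat.choose_pos (by lia)
  rw [aFun, div_le_iff₀ hpos, add_assoc]
  exact_mod_cast choose_two_mul_add_le l (j₁ + j₂) (l + j₁)

theorem sub_sub_nonneg_of_lt {j k r i : ℕ} (h : r + j ≤ k) (hi : i < j) :
    (0 : ℝ) ≤ (k : ℝ) - r - i := by
  have : (r : ℝ) + i ≤ k := by exact_mod_cast (by lia : r + i ≤ k)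
  linarith

theorem gammaFun_nonneg {j k r : ℕ} (h : r + j ≤ k) : 0 ≤ gammaFun j k r :=
  Finset.prod_nonneg fun _ hi => sub_sub_nonneg_of_lt h (Finset.mem_range.mp hi)

theorem gammaFun_le_pow {j k r : ℕ} (h : r + j ≤ k) :
    gammaFun j k r ≤ ((k : ℝ) - r) ^ j := by
  calc gammaFun j k r ≤ ∏ _i ∈ Finset.range j, ((k : ℝ) - r) :=
        Finset.prod_le_prod
          (fun _ hi => sub_sub_nonneg_of_lt h (Finset.mem_range.mp hi))
          (fun i _ => sub_le_self _ i.cast_nonneg)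
    _ = ((k : ℝ) - r) ^ j := by simp

theorem pow_le_betaFun (j₁ j₂ l r : ℕ) : (r : ℝ) ^ (j₁ + j₂) ≤ betaFun j₁ j₂ l r := by
  calc (r : ℝ) ^ (j₁ + j₂) = ∏ _i ∈ Finset.range (j₁ + j₂), (r : ℝ) := by simp
    _ ≤ betaFun j₁ j₂ l r := by
        refine Finset.prod_le_prod (fun _ _ => r.cast_nonneg) fun i _ => ?_
        have : (0 : ℝ) ≤ 2 * l + 1 + i := by positivity
        linarith

theorem muFun_le {j₁ j₂ k l r : ℕ} (hr : 1 ≤ r) (h₁ : r + j₁ ≤ k) (h₂ : r + j₂ ≤ k) :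
    muFun j₁ j₂ k l r ≤
      2 ^ (j₁ + j₂) * (((k : ℝ) - r) / r) ^ (j₁ + j₂) *
        (Nat.choose 3 j₁ : ℝ) * (Nat.choose 3 j₂ : ℝ) := by
  have hr0 : (0 : ℝ) < r := by exact_mod_cast hr
  have hkr : (0 : ℝ) ≤ (k : ℝ) - r :=
    sub_nonneg.mpr (by exact_mod_cast (by lia : r ≤ k))
  have hγ : gammaFun j₁ k r * gammaFun j₂ k r ≤ ((k : ℝ) - r) ^ (j₁ + j₂) := by
    rw [pow_add]
    exact mul_le_mul (gammaFun_le_pow h₁) (gammaFun_le_pow h₂) (gammaFun_nonneg h₂)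
      (by positivity)
  have hfrac : gammaFun j₁ k r * gammaFun j₂ k r * aFun j₁ j₂ l / betaFun j₁ j₂ l r ≤
      2 ^ (j₁ + j₂) * (((k : ℝ) - r) / r) ^ (j₁ + j₂) := by
    calc _ ≤ ((k : ℝ) - r) ^ (j₁ + j₂) * 2 ^ (j₁ + j₂) / (r : ℝ) ^ (j₁ + j₂) :=
          div_le_div₀ (by positivity)
            (mul_le_mul hγ (aFun_le_two_pow j₁ j₂ l) (aFun_nonneg j₁ j₂ l) (by positivity))
            (by positivity) (pow_le_betaFun j₁ j₂ l r)
      _ = _ := by rw [div_pow]; ring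
  unfold muFun
  gcongr

/-- Σ_{j₁,j₂=0}^{3} x^{j₁+j₂} μ(j₁,j₂,k,l,r) ≤ (2x(k−r)/r + 1)⁶, and termwise
μ(j₁,j₂,k,l,r) ≤ 2^{j₁+j₂}((k−r)/r)^{j₁+j₂} C(3,j₁) C(3,j₂). -/
theorem mu_sum_bound (k l r : ℕ) (hr1 : 1 ≤ r) (hrk : r + 3 ≤ k) (x : ℝ) (hx : 0 < x) :
    (∑ j₁ ∈ Finset.range 4, ∑ j₂ ∈ Finset.range 4,
        x ^ (j₁ + j₂) * muFun j₁ j₂ k l r) ≤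
      (2 * x * ((k : ℝ) - r) / r + 1) ^ 6 ∧
    ∀ j₁ ∈ Finset.range 4, ∀ j₂ ∈ Finset.range 4,
      muFun j₁ j₂ k l r ≤
        2 ^ (j₁ + j₂) * (((k : ℝ) - r) / r) ^ (j₁ + j₂) *
          (Nat.choose 3 j₁ : ℝ) * (Nat.choose 3 j₂ : ℝ) := by
  have hterm : ∀ j₁ ∈ Finset.range 4, ∀ j₂ ∈ Finset.range 4,
      muFun j₁ j₂ k l r ≤
        2 ^ (j₁ + j₂) * (((k : ℝ) - r) / r) ^ (j₁ + j₂) *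
          (Nat.choose 3 j₁ : ℝ) * (Nat.choose 3 j₂ : ℝ) := by
    intro j₁ hj₁ j₂ hj₂
    rw [Finset.mem_range] at hj₁ hj₂
    exact muFun_le hr1 (by lia) (by lia)
  refine ⟨?_, hterm⟩
  calc _ ≤ ∑ j₁ ∈ Finset.range 4, ∑ j₂ ∈ Finset.range 4,
        x ^ (j₁ + j₂) * (2 ^ (j₁ + j₂) * (((k : ℝ) - r) / r) ^ (j₁ + j₂) *
          (Nat.choose 3 j₁ : ℝ) * (Nat.choose 3 j₂ : ℝ)) :=
        Finset.sum_le_sum fun j₁ hj₁ => Finset.sum_le_sum fun j₂ hj₂ =>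
          mul_le_mul_of_nonneg_left (hterm j₁ hj₁ j₂ hj₂) (by positivity)
    _ = (2 * x * ((k : ℝ) - r) / r + 1) ^ 3 * (2 * x * ((k : ℝ) - r) / r + 1) ^ 3 := by
        rw [add_pow, Finset.sum_mul_sum]
        refine Finset.sum_congr rfl fun j₁ _ => Finset.sum_congr rfl fun j₂ _ => ?_
        rw [mul_div_assoc, mul_pow, mul_pow, mul_pow, mul_pow]
        ring
    _ = _ := by ring
end

section
/- Let x > 0 be real, set z = 1/√x, let k, l be positive integers, and let ν be a real with 0 < ν < z. Define f(r) = C(k,r)²·x^r / ((r+1)(r+2)⋯(r+2l)) for integers 0 ≤ r ≤ k. Then for every integer r with k(1+ν)/(z+1) ≤ r < k, one has f(r+1)/f(r) ≤ ((z−ν)/(z(1+ν)))², a quantity strictly less than 1. -/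
open Finset

/-- f(r) = C(k,r)² x^r / ((r+1)(r+2)⋯(r+2l)). -/
noncomputable def fFun (k l : ℕ) (x : ℝ) (r : ℕ) : ℝ :=
  (Nat.choose k r : ℝ) ^ 2 * x ^ r / ∏ i ∈ Finset.range (2 * l), ((r : ℝ) + 1 + i)

theorem choose_succ_le_mul_choose {z ν : ℝ} (hz : 0 < z) (hν : 0 < ν) {k r : ℕ}
    (hk : 0 < k) (hr : (k : ℝ) * (1 + ν) / (z + 1) ≤ r) (hrk : r < k) :
    (k.choose (r + 1) : ℝ) ≤ (z - ν) / (1 + ν) * k.choose r := by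
  have hk' : (0 : ℝ) < k := by exact_mod_cast hk
  have hrk' : (r : ℝ) < k := by exact_mod_cast hrk
  have hr0 : (0 : ℝ) < r := lt_of_lt_of_le (by positivity) hr
  rw [div_le_iff₀ (by positivity)] at hr
  have hrec : (k.choose (r + 1) : ℝ) * (r + 1) = k.choose r * (k - r) := by
    have h := Nat.choose_succ_right_eq k r
    rw [← Nat.cast_sub hrk.le]
    exact_mod_cast h
  have hbound : ((k : ℝ) - r) / (r + 1) ≤ (z - ν) / (1 + ν) := by
    rw [div_le_div_iff₀ (by positivity) (by positivity)]
    nlinarith [mul_pos hν hr0]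
  calc (k.choose (r + 1) : ℝ) = ((k : ℝ) - r) / (r + 1) * k.choose r := by
        field_simp
        linarith
    _ ≤ _ := by gcongr

theorem fFun_pos {k l r : ℕ} {x : ℝ} (hx : 0 < x) (hrk : r ≤ k) : 0 < fFun k l x r := by
  have := Nat.choose_pos hrk
  unfold fFun
  positivity

/-- Decay of the terms f(r) above r₀: for r ≥ k(1+ν)/(z+1) the ratio f(r+1)/f(r) is
at most ((z−ν)/(z(1+ν)))², which is strictly less than 1. -/
theorem f_ratio_decay (x : ℝ) (hx : 0 < x) (z : ℝ) (hz : z = 1 / Real.sqrt x)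
    (k l : ℕ) (hk : 0 < k) (hl : 0 < l) (ν : ℝ) (hν0 : 0 < ν) (hνz : ν < z) :
    ∀ r : ℕ, (k : ℝ) * (1 + ν) / (z + 1) ≤ r → r < k →
      fFun k l x (r + 1) / fFun k l x r ≤ ((z - ν) / (z * (1 + ν))) ^ 2 ∧
      ((z - ν) / (z * (1 + ν))) ^ 2 < 1 := by
  intro r hr hrk
  have hz0 : 0 < z := hν0.trans hνz
  have hxz : x = (1 / z) ^ 2 := by
    rw [hz, one_div_one_div, Real.sq_sqrt hx.le]
  have hB0 : 0 ≤ (z - ν) / (z * (1 + ν)) := div_nonneg (by linarith) (by positivity)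
  refine ⟨?_, ?_⟩
  · rw [div_le_iff₀ (fFun_pos hx hrk.le)]
    have hchoose := choose_succ_le_mul_choose hz0 hν0 hk hr hrk
    have hsq : (k.choose (r + 1) : ℝ) ^ 2 * x ≤
        ((z - ν) / (z * (1 + ν))) ^ 2 * (k.choose r : ℝ) ^ 2 := by
      rw [hxz, ← mul_pow, ← mul_pow]
      refine pow_le_pow_left₀ (by positivity) ?_ 2
      calc (k.choose (r + 1) : ℝ) * (1 / z)
          ≤ (z - ν) / (1 + ν) * k.choose r * (1 / z) := by gcongr
        _ = _ := by field_simp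
    unfold fFun
    rw [← mul_div_assoc]
    refine div_le_div₀ (by positivity) ?_ (by positivity) ?_
    · calc (k.choose (r + 1) : ℝ) ^ 2 * x ^ (r + 1)
          = (k.choose (r + 1) : ℝ) ^ 2 * x * x ^ r := by ring
        _ ≤ ((z - ν) / (z * (1 + ν))) ^ 2 * (k.choose r : ℝ) ^ 2 * x ^ r := by gcongr
        _ = _ := by ring
    · gcongr
      simp
  · refine pow_lt_one₀ hB0 ?_ two_ne_zero
    rw [div_lt_one (by positivity)]
    nlinarith [mul_pos hz0 hν0]
end

section
/- Let N ≥ 2 be an integer, R and h reals with 1 < R < N and 1 ≤ h < N, let k ≥ 1 and l ≥ 0 be integers, and let δ ∈ (0, 1/2) with h' = ⌊δh⌋ ≥ 2. Set H = {1,…,⌊h⌋}, H₁ = {integers i : 0 < i ≤ h'}, H₃ = {integers i : h − h' ≤ i ≤ h}, and assume H₁ ∩ H₃ = ∅. Define B₁ = Σ log(3N)·(Σ_{H' ⊆ H, |H'| = k} Λ_R(n;H',k+l))², where the outer sum runs over those integers n with N < n ≤ 2N such that n + H₁ contains exactly two primes and n + H₃ contains at least one prime; and define S₁ = Σ_{N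 < n ≤ 2N} Σ_{A₁ ⊆ H₁, |A₁| = 2} Σ_{A₂ ⊆ H₃, |A₂| = 1} Λ_R(n;A₁∪A₂,3)²·(Σ_{H' ⊆ H, |H'| = k} Λ_R(n;H'∖(A₁∪A₂),k+l))². Then B₁ ≤ (36·log(3N)/(log R)⁶)·S₁. -/
open Finset

/-- Removing from `H` elements `a` for which `n + a` is a prime exceeding `R` does not change the
sieve weight. -/
lemma lamR_sdiff {R : ℝ} {n : ℕ} (hn : 0 < n) (H A : Finset ℕ) (a : ℕ)
    (hA : ∀ i ∈ A, (n + i).Prime ∧ R < n) :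
    lamR R n (H \ A) a = lamR R n H a := by
  have hpos : ∀ S : Finset ℕ, ∏ i ∈ S, (n + i) ≠ 0 := fun S =>
    Finset.prod_ne_zero_iff.2 fun i _ => by omega
  unfold lamR
  congr 2
  ext d
  simp only [Finset.mem_filter, Nat.mem_divisors, hpos, ne_eq, not_false_eq_true, and_true]
  refine and_congr_left fun hdR => ⟨fun hd => hd.trans
    (Finset.prod_dvd_prod_of_subset _ _ _ Finset.sdiff_subset), fun hd => ?_⟩
  have hd0 : 0 < d := Nat.pos_of_dvd_of_pos hd (Nat.pos_of_ne_zero (hpos H))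
  rw [← Finset.prod_inter_mul_prod_sdiff H A] at hd
  refine Nat.Coprime.dvd_of_dvd_mul_left (Nat.Coprime.prod_right fun i hi => ?_) hd
  obtain ⟨hp, hR⟩ := hA i (Finset.mem_inter.1 hi).2
  refine ((hp.coprime_iff_not_dvd).2 fun hdvd => ?_).symm
  have hnd : n ≤ d := (Nat.le_add_right n i).trans (Nat.le_of_dvd hd0 hdvd)
  have : (n : ℝ) ≤ d := by exact_mod_cast hnd
  linarith

/-- If every `n + a`, `a ∈ A`, is a prime exceeding `R ≥ 1`, only the divisor `1` contributes. -/
lemma lamR_eq_of_forall_prime {R : ℝ} {n : ℕ} (hn : 0 < n) (hR : 1 ≤ R) (A : Finset ℕ) (a : ℕ)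
    (hA : ∀ i ∈ A, (n + i).Prime ∧ R < n) :
    lamR R n A a = Real.log R ^ a / a.factorial := by
  rw [← lamR_sdiff hn A A a hA]
  simp [lamR, Finset.filter_singleton, hR, div_eq_inv_mul]

/-- The upper bound B₁ ≤ (36 log(3N)/(log R)⁶)·S₁ relating the starred prime-counting
sum to the four-weight sieve sum. -/
theorem B1_le_S1 (N : ℕ) (hN : 2 ≤ N) (R h : ℝ) (hR1 : 1 < R) (hRN : R < N)
    (hh1 : 1 ≤ h) (hhN : h < N) (k l : ℕ) (hk : 1 ≤ k)
    (δ : ℝ) (hδ0 : 0 < δ) (hδ1 : δ < 1 / 2) (h' : ℕ) (hh' : h' = ⌊δ * h⌋₊) (hh'2 : 2 ≤ h')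
    (hdisj : Disjoint (Finset.Icc 1 h') (Finset.Icc ⌈h - (h' : ℝ)⌉₊ ⌊h⌋₊)) :
    (∑ n ∈ (Finset.Ioc N (2 * N)).filter (fun n =>
          ((Finset.Icc 1 h').filter (fun i => Nat.Prime (n + i))).card = 2 ∧
          1 ≤ ((Finset.Icc ⌈h - (h' : ℝ)⌉₊ ⌊h⌋₊).filter (fun i => Nat.Prime (n + i))).card),
        Real.log (3 * N) *
          (∑ H' ∈ (Finset.Icc 1 ⌊h⌋₊).powerset.filter (fun S => S.card = k),
            lamR R n H' (k + l)) ^ 2) ≤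
      (36 * Real.log (3 * N) / (Real.log R) ^ 6) *
        ∑ n ∈ Finset.Ioc N (2 * N),
          ∑ A₁ ∈ (Finset.Icc 1 h').powerset.filter (fun S => S.card = 2),
            ∑ A₂ ∈ (Finset.Icc ⌈h - (h' : ℝ)⌉₊ ⌊h⌋₊).powerset.filter (fun S => S.card = 1),
              (lamR R n (A₁ ∪ A₂) 3) ^ 2 *
                (∑ H' ∈ (Finset.Icc 1 ⌊h⌋₊).powerset.filter (fun S => S.card = k),
                  lamR R n (H' \ (A₁ ∪ A₂)) (k + l)) ^ 2 := by
  have hlogR : 0 < Real.log R := Real.log_pos hR1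
  have hlogN : 0 ≤ Real.log (3 * N) := Real.log_nonneg (by linarith)
  have hC : 0 ≤ 36 * Real.log (3 * N) / Real.log R ^ 6 := by positivity
  rw [Finset.mul_sum]
  refine (Finset.sum_le_sum fun n hn => ?_).trans
    (Finset.sum_le_sum_of_subset_of_nonneg (Finset.filter_subset _ _) fun n _ _ =>
      mul_nonneg hC (Finset.sum_nonneg fun A _ => Finset.sum_nonneg fun B _ =>
        mul_nonneg (sq_nonneg _) (sq_nonneg _)))
  obtain ⟨hnN, hcard, hex⟩ := Finset.mem_filter.1 hn
  have hn := (Finset.mem_Ioc.1 hnN).1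
  have hRn : R < n := hRN.trans (by exact_mod_cast hn)
  obtain ⟨j, hj⟩ := Finset.card_pos.1 hex
  obtain ⟨hjH, hjp⟩ := Finset.mem_filter.1 hj
  set A₁ := (Finset.Icc 1 h').filter (fun i => Nat.Prime (n + i)) with hA₁
  have hA : ∀ i ∈ A₁ ∪ {j}, (n + i).Prime ∧ R < n := by
    intro i hi
    refine ⟨?_, hRn⟩
    rcases Finset.mem_union.1 hi with hi | hi
    · exact (Finset.mem_filter.1 hi).2
    · rwa [Finset.mem_singleton.1 hi]
  have hn0 : 0 < n := by omega
  set F := fun A₁ A₂ : Finset ℕ => lamR R n (A₁ ∪ A₂) 3 ^ 2 *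
    (∑ H' ∈ (Finset.Icc 1 ⌊h⌋₊).powerset.filter (fun S => S.card = k),
      lamR R n (H' \ (A₁ ∪ A₂)) (k + l)) ^ 2 with hF
  have hF0 : ∀ A B, 0 ≤ F A B := fun A B => mul_nonneg (sq_nonneg _) (sq_nonneg _)
  have hle : F A₁ {j} ≤
      ∑ A₁ ∈ (Finset.Icc 1 h').powerset.filter (fun S => S.card = 2),
        ∑ A₂ ∈ (Finset.Icc ⌈h - (h' : ℝ)⌉₊ ⌊h⌋₊).powerset.filter (fun S => S.card = 1),
          F A₁ A₂ :=
    (Finset.single_le_sum (f := F A₁) (fun B _ => hF0 _ B) (Finset.mem_filter.2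
      ⟨Finset.mem_powerset.2 (Finset.singleton_subset_iff.2 hjH), Finset.card_singleton j⟩)).trans
    (Finset.single_le_sum
      (f := fun A => ∑ B ∈ (Finset.Icc ⌈h - (h' : ℝ)⌉₊ ⌊h⌋₊).powerset.filter
        (fun S => S.card = 1), F A B)
      (fun A _ => Finset.sum_nonneg fun B _ => hF0 A B)
      (Finset.mem_filter.2 ⟨Finset.mem_powerset.2 (Finset.filter_subset _ _), hcard⟩))
  refine le_trans (le_of_eq ?_) (mul_le_mul_of_nonneg_left hle hC)
  simp only [hF, lamR_sdiff hn0 _ _ _ hA, lamR_eq_of_forall_prime hn0 hR1.le _ _ hA]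
  norm_num [Nat.factorial]
  field_simp
  norm_num
end
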